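/- arXiv:1809.06946 — 2 statements merged into one kernel-verified Lean document; each statement's English description precedes it below -/
import Mathlib

section
/- For m ≥ 2 and n ≥ 3, the map ḡ : PConfₙ₊₁(D^m)/Σₙ → Confₙ(D^m) induced by forgetting the added point p₀ admits no continuous section. Equivalently, there is no continuous rule assigning to each set S of n distinct points of D^m a point f(S) ∈ D^m with f(S) ∉ S. -/
open Metric Function

noncomputable section

abbrev E (m : ℕ) := EuclideanSpace ℝ (Fin m)
def Dball (m : ℕ) : Set (E m) := Metric.closedBall 0 1

/-- Ordered configuration space of `n` distinct points in the closed unit ball. -/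
def PConf (m n : ℕ) : Set (Fin n → E m) :=
  {p | (∀ i, p i ∈ Dball m) ∧ Function.Injective p}

/-- The ordered configuration space of `n + 1` points `(p₀, p₁, …, pₙ)` in the closed
ball, encoded as a distinguished point `p₀` together with the remaining configuration. -/
def TotConf (m n : ℕ) : Set (E m × (Fin n → E m)) :=
  {x | x.1 ∈ Dball m ∧ (∀ i, x.2 i ∈ Dball m) ∧ Function.Injective x.2 ∧ ∀ i, x.1 ≠ x.2 i}

/-- The map forgetting the distinguished `0`th point. -/
def forget (m n : ℕ) (x : ↥(TotConf m n)) : ↥(PConf m n) :=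
  ⟨x.1.2, x.2.2.1, x.2.2.2.1⟩

instance (m n : ℕ) : SMul (Equiv.Perm (Fin n)) ↥(PConf m n) :=
  ⟨fun τ p => ⟨(p : Fin n → E m) ∘ ⇑τ⁻¹,
    fun i => p.2.1 _, p.2.2.comp (Equiv.injective _)⟩⟩

/-- `Σₙ` acts on ordered configurations by permuting the indices. -/
instance (m n : ℕ) : MulAction (Equiv.Perm (Fin n)) ↥(PConf m n) where
  one_smul p := Subtype.ext (by funext i; show (p : Fin n → E m) _ = _; simp)
  mul_smul τ ρ p := Subtype.ext (by
    funext i; show (p : Fin n → E m) _ = (p : Fin n → E m) _; simp [mul_inv_rev])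

instance (m n : ℕ) : SMul (Equiv.Perm (Fin n)) ↥(TotConf m n) :=
  ⟨fun τ x => ⟨(x.1.1, x.1.2 ∘ ⇑τ⁻¹),
    ⟨x.2.1, fun i => x.2.2.1 _, x.2.2.2.1.comp (Equiv.injective _),
      fun i => x.2.2.2.2 _⟩⟩⟩

/-- `Σₙ` acts on configurations of `n + 1` points by permuting the last `n` indices. -/
instance (m n : ℕ) : MulAction (Equiv.Perm (Fin n)) ↥(TotConf m n) where
  one_smul x := Subtype.ext (by
    refine Prod.ext rfl ?_
    funext i; show (x : E m × (Fin n → E m)).2 _ = _; simp)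
  mul_smul τ ρ x := Subtype.ext (by
    refine Prod.ext rfl ?_
    funext i
    show (x : E m × (Fin n → E m)).2 _ = (x : E m × (Fin n → E m)).2 _
    simp [mul_inv_rev])

/-- The unordered configuration space `Confₙ(D^m) = PConfₙ(D^m)/Σₙ`. -/
abbrev ConfQ (m n : ℕ) := Quotient (MulAction.orbitRel (Equiv.Perm (Fin n)) ↥(PConf m n))

/-- The quotient `PConfₙ₊₁(D^m)/Σₙ` by the action on the last `n` coordinates. -/
abbrev TotQ (m n : ℕ) := Quotient (MulAction.orbitRel (Equiv.Perm (Fin n)) ↥(TotConf m n))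

/-- The induced map `ḡ : PConfₙ₊₁(D^m)/Σₙ → Confₙ(D^m)`. -/
def gbar (m n : ℕ) : TotQ m n → ConfQ m n :=
  Quotient.map (forget m n) (by
    intro a b hab
    obtain ⟨τ, hτ⟩ := hab
    exact ⟨τ, by rw [← hτ]; rfl⟩)

def kvert {m : ℕ} (v : Fin m → ℤ) (σ : Equiv.Perm (Fin m)) (i : ℕ) : Fin m → ℤ :=
  fun l => v l + if (σ.symm l : ℕ) < i then 1 else 0

def kdoor {m : ℕ} (lam : (Fin m → ℤ) → Fin (m + 1)) (p : Fin m → (Fin m → ℤ)) : ℤ :=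
  Matrix.det (Matrix.of fun (i j : Fin m) => if lam (p i) = Fin.succ j then (1 : ℤ) else 0)

def kfull {m : ℕ} (lam : (Fin m → ℤ) → Fin (m + 1)) (v : Fin m → ℤ)
    (σ : Equiv.Perm (Fin m)) : ℤ :=
  Matrix.det (Matrix.of fun (i j : Fin (m + 1)) =>
    (Fin.cons 1 (fun j : Fin m => if lam (kvert v σ i) = j.succ then 1 else 0) : Fin (m+1) → ℤ) j)

def ksum {m : ℕ} (lam : (Fin m → ℤ) → Fin (m + 1)) (v : Fin m → ℤ) : ℤ :=
  ∑ σ : Equiv.Perm (Fin m), (Equiv.Perm.sign σ : ℤ) * kfull lam v σ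

lemma kfull_surj {m : ℕ} (lam : (Fin m → ℤ) → Fin (m + 1)) (v : Fin m → ℤ)
    (σ : Equiv.Perm (Fin m)) (h : kfull lam v σ ≠ 0) (j : Fin (m + 1)) :
    ∃ i : Fin (m + 1), lam (kvert v σ i) = j := by
  by_contra hne
  push Not at hne
  apply h
  refine Fin.cases ?_ ?_ j (motive := fun j => (∀ i : Fin (m + 1), lam (kvert v σ i) ≠ j) → _) hne
  · intro h0
    unfold kfull
    rw [← Matrix.exists_mulVec_eq_zero_iff]
    refine ⟨Fin.cons 1 (fun _ => -1), fun h => by simpa using congrFun h 0, ?_⟩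
    funext i
    obtain ⟨l, hl⟩ := Fin.exists_succ_eq.2 (h0 i)
    simp [Matrix.mulVec, dotProduct, Fin.sum_univ_succ, ← hl]
  · intro j hj
    exact Matrix.det_eq_zero_of_column_eq_zero j.succ (fun i => by simp [hj i])

lemma kfull_expand {m : ℕ} (lam : (Fin m → ℤ) → Fin (m + 1)) (v : Fin m → ℤ)
    (σ : Equiv.Perm (Fin m)) :
    kfull lam v σ = ∑ i : Fin (m + 1), (-1) ^ (i : ℕ) *
      kdoor lam (fun r => kvert v σ (i.succAbove r)) := by
  unfold kfull
  rw [Matrix.det_succ_column_zero]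
  refine Finset.sum_congr rfl fun i _ => ?_
  simp [kdoor]
  rfl

lemma kdoor_cancel {m : ℕ} (lam : (Fin m → ℤ) → Fin (m + 1)) (v : Fin m → ℤ)
    (i : ℕ) (hi : i + 1 < m) (I : Fin (m + 1)) (hI : (I : ℕ) = i + 1) :
    ∑ σ : Equiv.Perm (Fin m), (Equiv.Perm.sign σ : ℤ) *
      kdoor lam (fun r => kvert v σ (I.succAbove r)) = 0 := by
  set a : Fin m := ⟨i, by omega⟩
  set b : Fin m := ⟨i + 1, hi⟩
  have hab : a ≠ b := by simp [a, b]
  have key := Equiv.sum_comp (Equiv.mulRight (Equiv.swap a b)) (fun σ : Equiv.Perm (Fin m) =>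
    (Equiv.Perm.sign σ : ℤ) * kdoor lam (fun r => kvert v σ (I.succAbove r)))
  have h2 : ∀ σ : Equiv.Perm (Fin m), ∀ r : Fin m, kvert v (σ * Equiv.swap a b) (I.succAbove r)
      = kvert v σ (I.succAbove r) := by
    intro σ r
    funext l
    have hne : ((I.succAbove r : Fin (m + 1)) : ℕ) ≠ i + 1 := by
      rw [← hI]; exact fun h => Fin.succAbove_ne I r (Fin.ext h)
    generalize ((I.succAbove r : Fin (m + 1)) : ℕ) = t at hne
    simp only [kvert]
    have : ((σ * Equiv.swap a b).symm l) = Equiv.swap a b (σ.symm l) := by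
      rw [Equiv.symm_apply_eq]; simp
    rw [this]
    by_cases h1 : σ.symm l = a
    · rw [h1, Equiv.swap_apply_left]; simp only [a, b]; congr 2; simp; omega
    by_cases h2 : σ.symm l = b
    · rw [h2, Equiv.swap_apply_right]; simp only [a, b]; congr 2; simp; omega
    rw [Equiv.swap_apply_of_ne_of_ne h1 h2]
  simp only [Equiv.coe_mulRight, h2, Equiv.Perm.sign_mul, Equiv.Perm.sign_swap hab] at key
  simp only [mul_neg, mul_one, Units.val_neg, neg_mul, Finset.sum_neg_distrib] at key
  omega

lemma ksum_eq {m : ℕ} (lam : (Fin (m+1) → ℤ) → Fin (m + 2)) (v : Fin (m+1) → ℤ) :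
    ksum lam v = ∑ σ : Equiv.Perm (Fin (m+1)), (Equiv.Perm.sign σ : ℤ) * (-1) ^ m *
      (kdoor lam (fun r => kvert (v + Pi.single (σ (Fin.last m)) 1) σ r)
        - kdoor lam (fun r => kvert v σ r)) := by
  have h1 : ksum lam v = ∑ i : Fin (m + 2), (-1) ^ (i : ℕ) *
      ∑ σ : Equiv.Perm (Fin (m+1)), (Equiv.Perm.sign σ : ℤ) *
      kdoor lam (fun r => kvert v σ (i.succAbove r)) := by
    simp only [ksum, kfull_expand, Finset.mul_sum]
    rw [Finset.sum_comm]
    refine Finset.sum_congr rfl fun i _ => Finset.sum_congr rfl fun σ _ => by ring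
  have h0 : ∑ i : Fin m, (-1 : ℤ) ^ ((Fin.succ (Fin.castSucc i) : Fin (m+2)) : ℕ) *
      ∑ σ : Equiv.Perm (Fin (m+1)), (Equiv.Perm.sign σ : ℤ) *
      kdoor lam (fun r => kvert v σ ((Fin.succ (Fin.castSucc i)).succAbove r)) = 0 :=
    Finset.sum_eq_zero fun i _ => by
      rw [kdoor_cancel lam v (i : ℕ) (by omega) _ (by simp)]; simp
  have hrot := Equiv.sum_comp (Equiv.mulRight (finRotate (m+1)))
    (fun σ : Equiv.Perm (Fin (m+1)) => (Equiv.Perm.sign σ : ℤ) * (-1) ^ m *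
      kdoor lam (fun r => kvert (v + Pi.single (σ (Fin.last m)) 1) σ r))
  have hv : ∀ σ : Equiv.Perm (Fin (m+1)), ∀ r : Fin (m+1),
      kvert (v + Pi.single (σ 0) 1) (σ * finRotate (m+1)) r = kvert v σ ((r : ℕ) + 1) := by
    intro σ r
    funext l
    obtain ⟨c, rfl⟩ := σ.surjective l
    have e : (σ * finRotate (m+1)).symm (σ c) = (finRotate (m+1)).symm c := by
      rw [Equiv.symm_apply_eq]; simp
    simp only [kvert, Pi.add_apply, e, Equiv.symm_apply_apply]
    refine Fin.cases ?_ (fun c => ?_) c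
    · have : (finRotate (m+1)).symm 0 = Fin.last m := by
        rw [Equiv.symm_apply_eq, finRotate_last]
      rw [this]
      have hr : ¬ (m < (r : ℕ)) := by omega
      simp [hr]
    · have : (finRotate (m+1)).symm c.succ = c.castSucc := by
        rw [Equiv.symm_apply_eq]; simp
      rw [this]
      have hne : σ c.succ ≠ σ 0 := fun h => Fin.succ_ne_zero c (σ.injective h)
      simp [hne]
  have hsq : ∀ x : ℤ, x * (-1) ^ m * (-1) ^ m = x := by
    intro x; rw [mul_assoc, ← mul_pow]; simp
  simp only [Equiv.coe_mulRight, Equiv.Perm.mul_apply, finRotate_last, hv,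
    Equiv.Perm.sign_mul, sign_finRotate, Units.val_mul, Units.val_pow_eq_pow_val,
    Units.val_neg, Units.val_one] at hrot
  rw [h1, Fin.sum_univ_succ, Fin.sum_univ_castSucc, h0]
  simp only [mul_sub, Finset.sum_sub_distrib, ← hrot]
  simp [Finset.mul_sum, pow_succ, ← sub_eq_add_neg]
  congr 1
  · refine Finset.sum_congr rfl fun σ _ => by rw [hsq]
  · refine Finset.sum_congr rfl fun σ _ => by ring

lemma ksum_stokes {m : ℕ} (hm : 0 < m) (lam mu : (Fin m → ℤ) → Fin (m + 1))
    (hfin : {z | lam z ≠ mu z}.Finite) :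
    ∑ᶠ v, (ksum lam v - ksum mu v) = 0 := by
  obtain ⟨m, rfl⟩ : ∃ m', m = m' + 1 := ⟨m - 1, by omega⟩
  set F : Equiv.Perm (Fin (m+1)) → (Fin (m+1) → ℤ) → ℤ := fun σ v =>
    (Equiv.Perm.sign σ : ℤ) * (-1) ^ m *
      (kdoor lam (fun r => kvert v σ r) - kdoor mu (fun r => kvert v σ r)) with hF
  have hFfin : ∀ σ, (Function.support (F σ)).Finite := by
    intro σ
    have : Function.support (F σ) ⊆ ⋃ r : Fin (m+1),
        (fun v => kvert v σ r) ⁻¹' {z | lam z ≠ mu z} := by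
      intro v hv
      by_contra hc
      simp only [Set.mem_iUnion, Set.mem_preimage, Set.mem_ofPred_eq, not_exists, not_not] at hc
      apply hv
      simp [F, kdoor, hc]
    refine Set.Finite.subset (Set.finite_iUnion fun r => hfin.preimage ?_) this
    intro a _ b _ hab
    funext l
    simpa [kvert] using congrFun hab l
  have hFfin' : ∀ σ, (Function.support (fun v : Fin (m+1) → ℤ => F σ (v + Pi.single (σ (Fin.last m)) (1:ℤ)))).Finite := by
    intro σ
    exact (hFfin σ).preimage ((add_left_injective _).injOn)
  have : ∀ v, ksum lam v - ksum mu v = ∑ σ, (F σ (v + Pi.single (σ (Fin.last m)) (1:ℤ)) - F σ v) := by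
    intro v
    rw [ksum_eq, ksum_eq, ← Finset.sum_sub_distrib]
    refine Finset.sum_congr rfl fun σ _ => by simp only [hF]; ring
  simp only [this]
  clear_value F
  clear this hF
  rw [finsum_sum_comm]
  · refine Finset.sum_eq_zero fun σ _ => ?_
    rw [finsum_sub_distrib (hFfin' σ) (hFfin σ), sub_eq_zero]
    exact finsum_comp_equiv (Equiv.addRight (Pi.single (σ (Fin.last m)) (1 : ℤ))) (f := F σ)
  · intro σ _
    exact Set.Finite.subset ((hFfin' σ).union (hFfin σ)) (Function.support_sub _ _)

/-- hybrid lemma -/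
lemma ksum_hybrid {m : ℕ} (hm : 0 < m) (lam mu : (Fin m → ℤ) → Fin (m + 1))
    (A : Finset (Fin m → ℤ)) (I : Set (Fin m → ℤ)) (hIf : I.Finite)
    (h1 : ∀ v σ, ∀ i : Fin (m+1), kvert v σ i ∈ I → v ∈ A)
    (h2 : ∀ v ∈ A, ∀ σ, ∀ i : Fin (m+1), kvert v σ i ∉ I →
      ∀ nu : (Fin m → ℤ) → Fin (m + 1), (∀ z, nu z = lam z ∨ nu z = mu z) → kfull nu v σ = 0) :
    ∑ v ∈ A, ksum lam v = ∑ v ∈ A, ksum mu v := by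
  classical
  set nu : (Fin m → ℤ) → Fin (m + 1) := fun z => if z ∈ I then mu z else lam z with hnu
  have hnu' : ∀ z, nu z = lam z ∨ nu z = mu z := by
    intro z; simp only [hnu]; split_ifs <;> simp
  have key := ksum_stokes hm lam nu (hIf.subset (by
    intro z hz; by_contra hc; apply hz; simp [hnu, hc]))
  rw [finsum_eq_sum_of_support_subset (s := A)] at key
  · rw [Finset.sum_sub_distrib, sub_eq_zero] at key
    rw [key]
    refine Finset.sum_congr rfl fun v hv => Finset.sum_congr rfl fun σ _ => ?_
    congr 1
    by_cases hall : ∀ i : Fin (m+1), kvert v σ i ∈ I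
    · simp [kfull, hnu, hall]
    · push Not at hall
      obtain ⟨i, hi⟩ := hall
      rw [h2 v hv σ i hi nu hnu', h2 v hv σ i hi mu (fun _ => Or.inr rfl)]
  · intro v hv
    by_contra hc
    apply hv
    have : ∀ σ, ∀ i : Fin (m+1), kvert v σ i ∉ I := fun σ i hi => hc (h1 v σ i hi)
    simp [ksum, kfull, hnu, this]

def IsLab {m : ℕ} (L : (Fin m → ℝ) → Fin (m + 1)) : Prop :=
  ∀ y, (L y = 0 → ∀ i, y i ≤ 0) ∧ ∀ i, L y = Fin.succ i → 0 < y i ∧ ∀ j < i, y j ≤ 0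

lemma exists_lab (m : ℕ) : ∃ L : (Fin m → ℝ) → Fin (m + 1), IsLab L := by
  have : ∀ y : Fin m → ℝ, ∃ l : Fin (m+1), (l = 0 → ∀ i, y i ≤ 0) ∧
      ∀ i, l = Fin.succ i → 0 < y i ∧ ∀ j < i, y j ≤ 0 := by
    intro y
    by_cases h : ∃ i, 0 < y i
    · obtain ⟨i, hi, hmin⟩ := WellFounded.has_min (wellFounded_lt (α := Fin m)) {i | 0 < y i} h
      refine ⟨i.succ, fun h => absurd h (Fin.succ_ne_zero i), ?_⟩
      intro i' hi'
      obtain rfl := Fin.succ_injective _ hi'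
      exact ⟨hi, fun j hj => not_lt.1 fun hjp => hmin j hjp hj⟩
    · push Not at h
      exact ⟨0, fun _ => h, fun i hi => absurd hi.symm (Fin.succ_ne_zero i)⟩
  choose L hL using this
  exact ⟨L, hL⟩

/-- labels of close vectors -/
lemma lab_small {m : ℕ} (L : (Fin m → ℝ) → Fin (m + 1)) (hL : IsLab L)
    (y : Fin m → ℝ) (d : ℝ) (hd : 0 < d) (hy : d ≤ ‖y‖)
    (w : Fin (m + 1) → Fin m → ℝ) (hw : ∀ i, ‖w i - y‖ < d)
    (hs : ∀ j, ∃ i, L (w i) = j) : False := by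
  have : ‖y‖ < d := by
    rw [pi_norm_lt_iff hd]
    intro j
    obtain ⟨a, ha⟩ := hs 0
    obtain ⟨b, hb⟩ := hs j.succ
    have h1 := (hL _).1 ha j
    have h2 := ((hL _).2 j hb).1
    have h3 := (norm_le_pi_norm (w a - y) j).trans_lt (hw a)
    have h4 := (norm_le_pi_norm (w b - y) j).trans_lt (hw b)
    rw [Real.norm_eq_abs, abs_lt] at *
    simp only [Pi.sub_apply] at *
    constructor <;> linarith
  linarith

/-- the standard labelling has total count a unit -/
lemma ksum_std {m : ℕ} (L : (Fin m → ℝ) → Fin (m + 1)) (hL : IsLab L) (N : ℝ) (hN : 0 < N)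
    (lam : (Fin m → ℤ) → Fin (m + 1)) (hlam : ∀ z, lam z = L (fun i => - ((z i : ℝ) / N))) :
    (∀ v, v ≠ (fun _ => -1) → ∀ σ, kfull lam v σ = 0) ∧ IsUnit (ksum lam (fun _ => -1)) := by
  have hl0 : ∀ z, lam z = 0 → ∀ i, 0 ≤ z i := by
    intro z hz i
    have := (hL _).1 (hlam z ▸ hz) i
    have h : 0 ≤ (z i : ℝ) / N := by linarith
    have := mul_nonneg h hN.le
    rw [div_mul_cancel₀ _ hN.ne'] at this
    exact_mod_cast this
  have hl1 : ∀ z i, lam z = Fin.succ i → z i < 0 ∧ ∀ j < i, 0 ≤ z j := by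
    intro z i hz
    obtain ⟨h1, h2⟩ := (hL _).2 i (hlam z ▸ hz)
    constructor
    · have h : (z i : ℝ) / N < 0 := by linarith
      by_contra hc
      push Not at hc
      have : (0:ℝ) ≤ z i := by exact_mod_cast hc
      have := div_nonneg this hN.le
      linarith
    · intro j hj
      have h : 0 ≤ (z j : ℝ) / N := by linarith [h2 j hj]
      have := mul_nonneg h hN.le
      rw [div_mul_cancel₀ _ hN.ne'] at this
      exact_mod_cast this
  have main : ∀ v σ, kfull lam v σ ≠ 0 → v = (fun _ => -1) ∧ σ = 1 := by
    intro v σ h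
    have hs := kfull_surj lam v σ h
    have hmono : ∀ (a b : ℕ) l, a ≤ b → kvert v σ a l ≤ kvert v σ b l := by
      intro a b l hab
      simp only [kvert]
      split_ifs <;> omega
    obtain ⟨t, ht⟩ := hs 0
    choose a ha using fun i : Fin m => hs i.succ
    set A : Fin (m+1) → Fin (m+1) := Fin.snoc a t with hA
    have hlt : ∀ i : Fin m, ∀ p : Fin (m+1), 0 ≤ kvert v σ p i → a i < p := by
      intro i p hp
      by_contra hc
      have := hmono p (a i) i (by simpa using hc)
      have := (hl1 _ _ (ha i)).1
      omega
    have hAm : StrictMono A := by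
      intro i j hij
      have hi : i ≠ Fin.last m := ne_of_lt (lt_of_lt_of_le hij (Fin.le_last j))
      obtain ⟨i, rfl⟩ := Fin.exists_castSucc_eq.2 hi
      simp only [hA, Fin.snoc_castSucc]
      apply hlt
      refine Fin.lastCases (fun _ => ?_) (fun j hij => ?_) j hij
      · rw [Fin.snoc_last]; exact hl0 _ ht i
      · rw [Fin.snoc_castSucc]; exact (hl1 _ _ (ha j)).2 i (by simpa using hij)
    have hAid : A = id := by
      refine (StrictMono.range_inj hAm strictMono_id).1 ?_
      rw [Set.range_id]
      exact Set.range_eq_univ.2 (Finite.injective_iff_surjective.1 hAm.injective)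
    have hai : ∀ i : Fin m, a i = i.castSucc := by
      intro i
      have := congrFun hAid i.castSucc
      simpa [hA] using this
    have hti : t = Fin.last m := by
      have := congrFun hAid (Fin.last m)
      simpa [hA] using this
    have hneg : ∀ i : Fin m, kvert v σ i i < 0 := by
      intro i
      have := (hl1 _ _ (ha i)).1
      rw [hai] at this
      simpa using this
    have hpos : ∀ i : Fin m, 0 ≤ kvert v σ ((i : ℕ) + 1) i := by
      intro i
      by_cases hlast : (i : ℕ) + 1 = m
      · have := hl0 _ ht i
        rw [hti] at this
        simpa [hlast] using this
      · have := (hl1 _ _ (ha ⟨(i:ℕ)+1, by omega⟩)).2 i (by rw [Fin.lt_def]; simp)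
        rw [hai] at this
        simpa using this
    have hboth : ∀ i, v i = -1 ∧ (σ.symm i : ℕ) = i := by
      intro i
      have h1 := hneg i
      have h2 := hpos i
      simp only [kvert] at h1 h2
      split_ifs at h1 h2 <;> omega
    refine ⟨funext fun i => (hboth i).1, ?_⟩
    ext i
    have := (hboth (σ i)).2
    simp at this
    simp [← this]
  refine ⟨fun v hv σ => by_contra fun h => hv (main v σ h).1, ?_⟩
  have : ksum lam (fun _ => -1) = kfull lam (fun _ => -1) 1 := by
    unfold ksum
    rw [Finset.sum_eq_single 1]
    · simp
    · intro σ _ hσ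
      rw [by_contra fun h => hσ (main _ σ h).2, mul_zero]
    · simp
  rw [this]
  have hlab : ∀ i : Fin (m+1), lam (kvert (fun _ => -1) 1 i) =
      (Fin.snoc (fun i : Fin m => i.succ) 0 : Fin (m+1) → Fin (m+1)) i := by
    intro i
    set z := kvert (m := m) (fun _ => -1) 1 i with hz
    have hzl : ∀ l : Fin m, z l < 0 ↔ (i : ℕ) ≤ l := by
      intro l; simp [hz, kvert, ← Equiv.Perm.inv_def]; split_ifs <;> omega
    clear_value z
    obtain h | ⟨j, hj⟩ := Fin.eq_zero_or_eq_succ (lam z)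
    · have h0 := hl0 z h
      have : i = Fin.last m := by
        by_contra hne
        obtain ⟨i, rfl⟩ := Fin.exists_castSucc_eq.2 hne
        have := (hzl i).2 (by simp)
        have := h0 i
        omega
      rw [h, this, Fin.snoc_last]
    · obtain ⟨h1, h2⟩ := hl1 z j hj
      have h3 := (hzl j).1 h1
      have : i = j.castSucc := by
        apply Fin.ext
        by_contra hne
        simp at hne
        have h4 := h2 ⟨i, by omega⟩ (by rw [Fin.lt_def]; simp; omega)
        have := (hzl ⟨i, by omega⟩).2 le_rfl
        omega
      rw [hj, this, Fin.snoc_castSucc]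
  unfold kfull
  simp only [hlab]
  have hd := Matrix.det_permute (finRotate (m+1)).symm (Matrix.of fun (i j : Fin (m + 1)) =>
    (Fin.cons 1 (fun j : Fin m => if (Fin.snoc (fun i : Fin m => i.succ) 0 :
      Fin (m+1) → Fin (m+1)) i = j.succ then 1 else 0) : Fin (m+1) → ℤ) j)
  rw [Matrix.det_of_isLowerTriangular] at hd
  · refine IsUnit.of_mul_eq_one _ ((mul_comm _ _).trans (hd.symm.trans ?_))
    refine Finset.prod_eq_one fun i _ => ?_
    refine Fin.cases (by simp) (fun i => ?_) i
    have : (finRotate (m+1)).symm i.succ = i.castSucc := by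
      rw [Equiv.symm_apply_eq]; simp
    simp [this]
  · intro i j hij
    simp only [OrderDual.toDual_lt_toDual] at hij
    obtain ⟨j, rfl⟩ := Fin.exists_succ_eq.2 (ne_of_gt (lt_of_le_of_lt (Fin.zero_le i) hij))
    revert hij
    refine Fin.cases (fun _ => ?_) (fun i hij => ?_) i
    · have : (finRotate (m+1)).symm 0 = Fin.last m := by
        rw [Equiv.symm_apply_eq, finRotate_last]
      simp [this]
      exact fun h => Fin.succ_ne_zero j h.symm
    · have : (finRotate (m+1)).symm i.succ = i.castSucc := by
        rw [Equiv.symm_apply_eq]; simp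
      simp [this]
      rintro rfl
      exact absurd hij (lt_irrefl _)


lemma kvert_add {m : ℕ} (v c : Fin m → ℤ) (σ : Equiv.Perm (Fin m)) (i : ℕ) :
    kvert (v + c) σ i = kvert v σ i + c := by
  funext l; simp [kvert]; ring

lemma ksum_shift {m : ℕ} (lam : (Fin m → ℤ) → Fin (m + 1)) (v c : Fin m → ℤ) :
    ksum lam (v + c) = ksum (fun z => lam (z + c)) v := by
  simp [ksum, kfull, kvert_add]

lemma kvert_bd {m : ℕ} (v : Fin m → ℤ) (σ : Equiv.Perm (Fin m)) (i : ℕ) (l : Fin m) :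
    v l ≤ kvert v σ i l ∧ kvert v σ i l ≤ v l + 1 := by
  simp only [kvert]; split_ifs <;> omega

lemma unif_away {X Y : Type*} [PseudoMetricSpace X] [NormedAddCommGroup Y] (g : X → Y)
    (K : Set X) (hK : IsCompact K) (hc : ∀ p ∈ K, ContinuousAt g p) (h0 : ∀ p ∈ K, g p ≠ 0) :
    ∃ d > 0, ∃ η > 0, ∀ p ∈ K, d ≤ ‖g p‖ ∧ ∀ p', dist p' p < η → ‖g p' - g p‖ < d := by
  have hd : ∃ d > 0, ∀ p ∈ K, d ≤ ‖g p‖ := by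
    rcases K.eq_empty_or_nonempty with rfl | hne
    · exact ⟨1, one_pos, by simp⟩
    · obtain ⟨x, hx, hmin⟩ := hK.exists_isMinOn hne
        (fun p hp => (hc p hp).norm.continuousWithinAt)
      exact ⟨‖g x‖, norm_pos_iff.2 (h0 x hx), fun p hp => hmin hp⟩
  obtain ⟨d, hd, hdK⟩ := hd
  have := hK.uniformContinuousAt_of_continuousAt g hc (Metric.dist_mem_uniformity hd)
  obtain ⟨η, hη, h⟩ := Metric.mem_uniformity_dist.1 this
  refine ⟨d, hd, η, hη, fun p hp => ⟨hdK p hp, fun p' hp' => ?_⟩⟩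
  have h2 := h (a := p) (b := p') (by rwa [dist_comm]) hp
  rw [← dist_eq_norm, dist_comm]
  exact h2

set_option maxHeartbeats 4000000 in
theorem degree_core {m k : ℕ} (hm : 0 < m) (hk : 2 ≤ k) (q : ℝ → Fin m → ℝ) (hq : Continuous q)
    (hsep : ∀ s : ℝ, ∀ j : ℕ, 0 < j → j < k → q (s + j / k) ≠ q s)
    (hq1 : ∀ s, ‖q s‖ ≤ 1)
    (G : ℝ → (Fin m → ℝ) → (Fin m → ℝ))
    (hGc : ∀ p : ℝ × (Fin m → ℝ), (∀ j : ℕ, j < k → p.2 ≠ q (p.1 + j / k)) →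
      ContinuousAt (fun p : ℝ × (Fin m → ℝ) => G p.1 p.2) p)
    (hG0 : ∀ p : ℝ × (Fin m → ℝ), (∀ j : ℕ, j < k → p.2 ≠ q (p.1 + j / k)) → G p.1 p.2 ≠ 0)
    (hGper : ∀ s x, G (s + 1 / k) x = G s x)
    (hGout : ∀ s x, 2 ≤ ‖x‖ → G s x = -x) : False := by
  obtain ⟨L, hL⟩ := exists_lab m
  have hk0 : (0:ℝ) < k := by exact_mod_cast (by omega : 0 < k)
  -- separation
  have hρ : ∃ ρ > 0, ρ ≤ 1/8 ∧ ∀ s ∈ Set.Icc (0:ℝ) 1, ∀ j : ℕ, 0 < j → j < k →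
      8 * ρ ≤ ‖q (s + j / k) - q s‖ := by
    have : ∀ j : ℕ, ∃ d > 0, 0 < j → j < k → ∀ s ∈ Set.Icc (0:ℝ) 1, d ≤ ‖q (s + j / k) - q s‖ := by
      intro j
      by_cases hj : 0 < j ∧ j < k
      · obtain ⟨d, hd, η, hη, h⟩ := unif_away (fun s => q (s + j / k) - q s) (Set.Icc (0:ℝ) 1)
          isCompact_Icc (fun p _ => by fun_prop) (fun s _ => sub_ne_zero.2 (hsep s j hj.1 hj.2))
        exact ⟨d, hd, fun _ _ s hs => (h s hs).1⟩
      · exact ⟨1, one_pos, fun h1 h2 => absurd ⟨h1, h2⟩ hj⟩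
    choose d hd hdj using this
    have hne : (Finset.range k).Nonempty := ⟨0, by simp; omega⟩
    obtain ⟨j0, _, hj0⟩ := Finset.exists_min_image (Finset.range k) d hne
    refine ⟨min (d j0 / 8) (1/8), lt_min (by linarith [hd j0]) (by norm_num), min_le_right _ _, ?_⟩
    intro s hs j h1 h2
    have := hdj j h1 h2 s hs
    have := hj0 j (by simpa using h2)
    have := min_le_left (d j0 / 8) (1/8)
    linarith
  obtain ⟨ρ, hρ, hρ8, hρs⟩ := hρ
  set K : Set (ℝ × (Fin m → ℝ)) := {p | p.1 ∈ Set.Icc (0:ℝ) 1 ∧ ‖p.2‖ ≤ 3 ∧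
    ∀ j : ℕ, j < k → ρ ≤ ‖p.2 - q (p.1 + j / k)‖} with hKdef
  have hK : IsCompact K := by
    have : IsCompact (Set.Icc (0:ℝ) 1 ×ˢ Metric.closedBall (0 : Fin m → ℝ) 3) :=
      isCompact_Icc.prod (isCompact_closedBall _ _)
    refine this.of_isClosed_subset ?_ ?_
    · have h1 : IsClosed {p : ℝ × (Fin m → ℝ) | p.1 ∈ Set.Icc (0:ℝ) 1} :=
        isClosed_Icc.preimage continuous_fst
      have h2 : IsClosed {p : ℝ × (Fin m → ℝ) | ‖p.2‖ ≤ 3} :=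
        isClosed_le (by fun_prop) (by fun_prop)
      have h3 : IsClosed {p : ℝ × (Fin m → ℝ) | ∀ j : ℕ, j < k → ρ ≤ ‖p.2 - q (p.1 + j / k)‖} := by
        simp only [Set.ofPred_forall]
        exact isClosed_iInter fun j => isClosed_iInter fun _ =>
          isClosed_le (by fun_prop) (by fun_prop)
      exact h1.inter (h2.inter h3)
    · rintro ⟨s, x⟩ ⟨h1, h2, _⟩
      exact ⟨h1, by simpa using h2⟩
  have hKU : ∀ p ∈ K, ∀ j : ℕ, j < k → p.2 ≠ q (p.1 + j / k) := by
    rintro p ⟨_, _, h⟩ j hj he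
    have := h j hj
    rw [he, sub_self, norm_zero] at this
    linarith
  obtain ⟨d, hd, η, hη, hunif⟩ := unif_away (fun p : ℝ × (Fin m → ℝ) => G p.1 p.2) K hK
    (fun p hp => hGc p (hKU p hp)) (fun p hp => hG0 p (hKU p hp))
  have noFull : ∀ p ∈ K, ∀ (nu : (Fin m → ℤ) → Fin (m+1)) v σ,
      (∀ i : Fin (m+1), ∃ p' : ℝ × (Fin m → ℝ), dist p' p < η ∧ nu (kvert v σ i) = L (G p'.1 p'.2)) →
      kfull nu v σ = 0 := by
    intro p hp nu v σ h
    by_contra hne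
    have hs := kfull_surj nu v σ hne
    choose p' hp' hnu using h
    refine lab_small L hL (G p.1 p.2) d hd (hunif p hp).1 (fun i => G (p' i).1 (p' i).2)
      (fun i => (hunif p hp).2 _ (hp' i)) ?_
    intro j
    obtain ⟨i, hi⟩ := hs j
    exact ⟨i, by rw [← hi, hnu]⟩
  -- choice of N
  obtain ⟨N, hN⟩ := exists_nat_gt (max (max (4 / η) (4 / ρ)) 4)
  have hN4 : (4:ℝ) < N := lt_of_le_of_lt (le_max_right _ _) hN
  have hN0 : (0:ℝ) < N := by linarith
  have hNη : 4 / (N:ℝ) < η := by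
    rw [div_lt_comm₀ hN0 hη]
    exact lt_of_le_of_lt ((le_max_left _ _).trans (le_max_left _ _)) hN
  have hNρ : 4 < ρ * N := by
    have : 4 / ρ < N := lt_of_le_of_lt ((le_max_right _ _).trans (le_max_left _ _)) hN
    rwa [div_lt_iff₀' hρ] at this
  set M : ℤ := ⌊2 * ρ * N⌋ with hMdef
  have hM1 : (M:ℝ) ≤ 2 * ρ * N := Int.floor_le _
  have hM2 : 2 * ρ * N < M + 1 := Int.lt_floor_add_one _
  set Z : ℝ → Fin m → ℤ := fun s l => ⌊N * q s l⌋ with hZ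
  have hZ1 : ∀ s l, (Z s l : ℝ) ≤ N * q s l := fun s l => Int.floor_le _
  have hZ2 : ∀ s l, N * q s l < Z s l + 1 := fun s l => Int.lt_floor_add_one _
  clear_value Z M
  set P : ℝ → (Fin m → ℤ) → Fin m → ℝ := fun s z l => ((z l : ℝ) + Z s l) / N with hP
  set u : ℝ → (Fin m → ℤ) → Fin (m+1) := fun s z => L (G s (P s z)) with hu
  set A : Finset (Fin m → ℤ) := Finset.Icc (fun _ => -(M+1)) (fun _ => M + 1) with hA
  obtain ⟨η', hη', hqη⟩ : ∃ η' > 0, ∀ s ∈ Set.Icc (0:ℝ) 1, ∀ s', dist s' s < η' →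
      dist (q s') (q s) < η / 2 := by
    have := (isCompact_Icc (a := (0:ℝ)) (b := 1)).uniformContinuousAt_of_continuousAt q
      (fun s _ => hq.continuousAt) (Metric.dist_mem_uniformity (half_pos hη))
    obtain ⟨e, he, h⟩ := Metric.mem_uniformity_dist.1 this
    refine ⟨e, he, fun s hs s' hs' => ?_⟩
    rw [dist_comm]
    exact h (by rwa [dist_comm]) hs
  have step : ∀ s ∈ Set.Icc (0:ℝ) 1, ∀ s', dist s' s < η → dist s' s < η' →
      ∑ v ∈ A, ksum (u s) v = ∑ v ∈ A, ksum (u s') v := by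
    intro s hs s' hs1 hs2
    have hqq := hqη s hs s' hs2
    refine ksum_hybrid hm (u s) (u s') A (Finset.Icc (fun _ => -M) (fun _ => M) : Finset (Fin m → ℤ))
      (Finset.finite_toSet _) ?_ ?_
    · intro v σ i hi
      simp only [Finset.coe_Icc, Set.mem_Icc, Pi.le_def] at hi
      simp only [hA, Finset.mem_Icc, Pi.le_def]
      exact ⟨fun l => by have := hi.1 l; have := kvert_bd v σ i l; omega,
        fun l => by have := hi.2 l; have := kvert_bd v σ i l; omega⟩
    · intro v hv σ i hi nu hnu
      simp only [hA, Finset.mem_Icc, Pi.le_def] at hv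
      have hl : ∃ l, M ≤ v l ∨ v l ≤ -M := by
        by_contra hc
        push Not at hc
        apply hi
        simp only [Finset.coe_Icc, Set.mem_Icc, Pi.le_def]
        exact ⟨fun l => by have := hc l; have := kvert_bd v σ i l; omega,
          fun l => by have := hc l; have := kvert_bd v σ i l; omega⟩
      have hup : ‖P s v - q s‖ ≤ 3 * ρ := by
        rw [pi_norm_le_iff_of_nonneg (by linarith)]
        intro l
        have h1 : (-(M+1) : ℝ) ≤ v l := by exact_mod_cast hv.1 l
        have h2 : (v l : ℝ) ≤ M + 1 := by exact_mod_cast hv.2 l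
        have e : (P s v - q s) l = (v l + Z s l - N * q s l) / N := by
          simp only [hP, Pi.sub_apply]; field_simp
        rw [e, Real.norm_eq_abs, abs_le]
        have := hZ1 s l
        have := hZ2 s l
        constructor
        · rw [le_div_iff₀ hN0]; nlinarith
        · rw [div_le_iff₀ hN0]; nlinarith
      have hlow : ρ ≤ ‖P s v - q s‖ := by
        obtain ⟨l, hl⟩ := hl
        refine le_trans ?_ (norm_le_pi_norm _ l)
        have e : (P s v - q s) l = (v l + Z s l - N * q s l) / N := by
          simp only [hP, Pi.sub_apply]; field_simp
        rw [e, Real.norm_eq_abs, le_abs]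
        have := hZ1 s l
        have := hZ2 s l
        rcases hl with hl | hl
        · left
          have : (M:ℝ) ≤ v l := by exact_mod_cast hl
          rw [le_div_iff₀ hN0]; nlinarith
        · right
          have : (v l : ℝ) ≤ -M := by exact_mod_cast hl
          rw [← neg_div, le_div_iff₀ hN0]; nlinarith
      have hpK : (s, P s v) ∈ K := by
        refine ⟨hs, ?_, fun j hj => ?_⟩
        · have := norm_le_norm_add_norm_sub' (P s v) (q s)
          have := hq1 s
          simp only
          linarith
        · rcases Nat.eq_zero_or_pos j with rfl | hj0
          · simpa using hlow
          · have h1 := hρs s hs j hj0 hj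
            have h2 := norm_sub_le_norm_sub_add_norm_sub (q (s + j/k)) (P s v) (q s)
            rw [norm_sub_rev (q (s + j/k)) (P s v)] at h2
            simp only
            linarith
      refine noFull _ hpK nu v σ fun i => ?_
      have h4 : 2 / (N:ℝ) < η / 2 := by
        have : 4 / (N:ℝ) = 2 * (2 / N) := by ring
        linarith
      have hb := fun l => kvert_bd v σ i l
      rcases hnu (kvert v σ i) with h | h
      · refine ⟨(s, P s (kvert v σ i)), ?_, h⟩
        rw [Prod.dist_eq, dist_self]
        refine max_lt hη ?_
        rw [dist_pi_lt_iff hη]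
        intro l
        have h1 : (v l : ℝ) ≤ kvert v σ i l := by exact_mod_cast (hb l).1
        have h2 : (kvert v σ i l : ℝ) ≤ v l + 1 := by exact_mod_cast (hb l).2
        have e : P s (kvert v σ i) l - P s v l = (kvert v σ i l - v l) / N := by
          simp only [hP]; field_simp; ring
        rw [Real.dist_eq, e, abs_lt]
        refine ⟨lt_of_lt_of_le (neg_lt_zero.2 hη) (div_nonneg (by linarith) hN0.le), ?_⟩
        have : ((kvert v σ i l : ℝ) - v l) / N ≤ 2 / N :=
          div_le_div_of_nonneg_right (by linarith) hN0.le
        linarith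
      · refine ⟨(s', P s' (kvert v σ i)), ?_, h⟩
        rw [Prod.dist_eq]
        refine max_lt hs1 ?_
        rw [dist_pi_lt_iff hη]
        intro l
        have h1 : (v l : ℝ) ≤ kvert v σ i l := by exact_mod_cast (hb l).1
        have h2 : (kvert v σ i l : ℝ) ≤ v l + 1 := by exact_mod_cast (hb l).2
        have e : P s' (kvert v σ i) l - P s v l = (kvert v σ i l - v l +
            ((Z s' l - N * q s' l) - (Z s l - N * q s l))) / N + (q s' l - q s l) := by
          simp only [hP]; field_simp; ring
        have h3 := (dist_le_pi_dist (q s') (q s) l).trans_lt hqq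
        rw [Real.dist_eq, abs_lt] at h3
        have := hZ1 s l
        have := hZ2 s l
        have := hZ1 s' l
        have := hZ2 s' l
        have h5 : ((kvert v σ i l : ℝ) - v l +
            ((Z s' l - N * q s' l) - (Z s l - N * q s l))) / N ≤ 2 / N :=
          div_le_div_of_nonneg_right (by linarith) hN0.le
        have h6 : -(2 / N) ≤ ((kvert v σ i l : ℝ) - v l +
            ((Z s' l - N * q s' l) - (Z s l - N * q s l))) / N := by
          rw [← neg_div]
          exact div_le_div_of_nonneg_right (by linarith) hN0.le
        rw [Real.dist_eq, e, abs_lt]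
        constructor <;> linarith
  -- chain
  have hchain : ∀ j : ℕ, j < k → ∑ v ∈ A, ksum (u (j / k)) v = ∑ v ∈ A, ksum (u 0) v := by
    obtain ⟨T, hT⟩ := exists_nat_gt (max (1 / η) (1 / η'))
    have hT0 : (0:ℝ) < T := lt_of_le_of_lt (le_max_of_le_left (by positivity)) hT
    have hTη : 1 / (T:ℝ) < η := by
      rw [div_lt_comm₀ hT0 hη]; exact lt_of_le_of_lt (le_max_left _ _) hT
    have hTη' : 1 / (T:ℝ) < η' := by
      rw [div_lt_comm₀ hT0 hη']; exact lt_of_le_of_lt (le_max_right _ _) hT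
    have hTk : 1 / ((k:ℝ) * T) ≤ 1 / T := by
      apply one_div_le_one_div_of_le hT0
      have : (1:ℝ) ≤ k := by exact_mod_cast (by omega : 1 ≤ k)
      nlinarith
    have hind : ∀ i : ℕ, i ≤ k * T →
        ∑ v ∈ A, ksum (u ((i:ℝ) / (k * T))) v = ∑ v ∈ A, ksum (u 0) v := by
      intro i
      induction i with
      | zero => intro _; simp
      | succ i ih =>
        intro hi
        rw [← ih (by omega)]
        symm
        have hdist : dist (((i + 1 : ℕ) : ℝ) / (k * T)) ((i:ℝ) / (k * T)) = 1 / (k * T) := by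
          rw [Real.dist_eq, ← sub_div]
          push_cast
          rw [add_sub_cancel_left, abs_of_pos (by positivity)]
        apply step
        · constructor
          · positivity
          · rw [div_le_one (by positivity)]
            exact_mod_cast (by omega : i ≤ k * T)
        · rw [hdist]; linarith
        · rw [hdist]; linarith
    intro j hj
    have := hind (j * T) (Nat.mul_le_mul_right T hj.le)
    rw [← this]
    have e : ((j * T : ℕ) : ℝ) / (k * T) = j / k := by
      push_cast
      rw [mul_div_mul_right _ _ hT0.ne']
    rw [e]
  -- global count
  set w0 : (Fin m → ℤ) → Fin (m+1) := fun z => L (G 0 (fun l => (z l : ℝ) / N)) with hw0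
  set lm : (Fin m → ℤ) → Fin (m+1) := fun z => L (fun l => - ((z l : ℝ) / N)) with hlm
  obtain ⟨hst1, hst2⟩ := ksum_std L hL N hN0 lm (fun z => rfl)
  set Big : Finset (Fin m → ℤ) := Finset.Icc (fun _ => -(3 * (N:ℤ))) (fun _ => 3 * (N:ℤ)) with hBig
  have hNZ : (4:ℤ) < N := by exact_mod_cast hN4
  have hw0lm : ∀ z : Fin m → ℤ, (∃ l, 2 * (N:ℤ) ≤ z l ∨ z l ≤ - (2 * (N:ℤ))) → w0 z = lm z := by
    rintro z ⟨l, hl⟩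
    simp only [hw0, hlm]
    rw [hGout]
    · rfl
    · refine le_trans ?_ (norm_le_pi_norm _ l)
      rw [Real.norm_eq_abs, le_abs]
      rcases hl with hl | hl
      · left
        rw [le_div_iff₀ hN0]; exact_mod_cast hl
      · right
        rw [← neg_div, le_div_iff₀ hN0]
        have : (z l : ℝ) ≤ -(2 * N) := by exact_mod_cast hl
        linarith
  have htot : ∑ v ∈ Big, ksum w0 v = ksum lm (fun _ => -1) := by
    have key := ksum_stokes hm w0 lm (Set.Finite.subset (Finset.finite_toSet Big) (by
      intro z hz
      by_contra hc
      apply hz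
      apply hw0lm
      by_contra hn
      push Not at hn
      apply hc
      simp only [hBig, Finset.coe_Icc, Set.mem_Icc, Pi.le_def]
      exact ⟨fun l => by have := hn l; omega, fun l => by have := hn l; omega⟩))
    rw [finsum_eq_sum_of_support_subset (s := Big)] at key
    · rw [Finset.sum_sub_distrib, sub_eq_zero] at key
      rw [key, Finset.sum_eq_single (fun _ => -1)]
      · intro v _ hv
        simp [ksum, hst1 v hv]
      · intro h
        exfalso; apply h
        simp only [hBig, Finset.mem_Icc, Pi.le_def]
        exact ⟨fun l => by omega, fun l => by omega⟩
    · intro v hv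
      by_contra hc
      apply hv
      have hl : ∃ l, 3 * (N:ℤ) < v l ∨ v l < - (3 * (N:ℤ)) := by
        by_contra hn
        push Not at hn
        apply hc
        simp only [hBig, Finset.coe_Icc, Set.mem_Icc, Pi.le_def]
        exact ⟨fun l => by have := hn l; omega, fun l => by have := hn l; omega⟩
      obtain ⟨l, hl⟩ := hl
      have : ∀ σ (i : Fin (m+1)), w0 (kvert v σ i) = lm (kvert v σ i) := by
        intro σ i
        apply hw0lm
        have := kvert_bd v σ i l
        exact ⟨l, by omega⟩
      simp [ksum, kfull, this]
  have hper : ∀ j : ℕ, ∀ x, G (j / k) x = G 0 x := by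
    intro j x
    induction j with
    | zero => simp
    | succ j ih =>
      have e : ((j + 1 : ℕ) : ℝ) / k = j / k + 1 / k := by
        push_cast
        ring
      rw [← ih, e, hGper]
  have hus : ∀ j : ℕ, ∀ v, ksum w0 (v + Z (j / k)) = ksum (u (j / k)) v := by
    intro j v
    rw [ksum_shift]
    congr 1
    funext z
    simp only [hw0, hu, hper, hP, Pi.add_apply, Int.cast_add]
  set S : ℕ → Finset (Fin m → ℤ) := fun j => A.image (fun v => v + Z (j / k)) with hS
  have hIcc : ∀ j : ℕ, j < k → ((j:ℝ) / k) ∈ Set.Icc (0:ℝ) 1 := by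
    intro j hj
    refine ⟨by positivity, ?_⟩
    rw [div_le_one hk0]
    exact_mod_cast hj.le
  have hdisj : ∀ i j : ℕ, i < j → j < k → Disjoint (S i) (S j) := by
    intro i j hij hj
    rw [Finset.disjoint_left]
    intro v hvi hvj
    simp only [hS, Finset.mem_image] at hvi hvj
    obtain ⟨a, ha, hav⟩ := hvi
    obtain ⟨b, hb, hbv⟩ := hvj
    simp only [hA, Finset.mem_Icc, Pi.le_def] at ha hb
    have h1 := hρs (i / k) (hIcc i (by omega)) (j - i) (by omega) (by omega)
    have e : (i:ℝ) / k + ((j - i : ℕ) : ℝ) / k = j / k := by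
      rw [Nat.cast_sub hij.le]; ring
    rw [e] at h1
    have h2 : ‖q (j / k) - q (i / k)‖ ≤ 6 * ρ := by
      rw [pi_norm_le_iff_of_nonneg (by linarith)]
      intro l
      have hab : a l + Z (i / k) l = b l + Z (j / k) l := by
        have := congrFun (hav.trans hbv.symm) l
        simpa using this
      have hab' : (a l : ℝ) + Z (i / k) l = b l + Z (j / k) l := by exact_mod_cast hab
      have a1 : (-(M+1) : ℝ) ≤ a l := by exact_mod_cast ha.1 l
      have a2 : (a l : ℝ) ≤ M + 1 := by exact_mod_cast ha.2 l
      have b1 : (-(M+1) : ℝ) ≤ b l := by exact_mod_cast hb.1 l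
      have b2 : (b l : ℝ) ≤ M + 1 := by exact_mod_cast hb.2 l
      have := hZ1 (i / k) l
      have := hZ2 (i / k) l
      have := hZ1 (j / k) l
      have := hZ2 (j / k) l
      rw [Pi.sub_apply, Real.norm_eq_abs, abs_le]
      constructor
      · refine le_of_mul_le_mul_left ?_ hN0
        nlinarith
      · refine le_of_mul_le_mul_left ?_ hN0
        nlinarith
    linarith
  have hsumS : ∑ v ∈ Big, ksum w0 v = ∑ v ∈ (Finset.range k).biUnion S, ksum w0 v := by
    symm
    apply Finset.sum_subset
    · intro v hv
      simp only [Finset.mem_biUnion, Finset.mem_range, hS, Finset.mem_image] at hv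
      obtain ⟨j, hj, a, ha, rfl⟩ := hv
      simp only [hA, Finset.mem_Icc, Pi.le_def] at ha
      simp only [hBig, Finset.mem_Icc, Pi.le_def]
      have hql : ∀ l, -1 ≤ q (j / k) l ∧ q (j / k) l ≤ 1 := by
        intro l
        have := (norm_le_pi_norm (q (j / k)) l).trans (hq1 _)
        rwa [Real.norm_eq_abs, abs_le] at this
      have hMN : (M:ℝ) ≤ N / 4 := by nlinarith
      constructor
      · intro l
        have a1 : (-(M+1) : ℝ) ≤ a l := by exact_mod_cast ha.1 l
        have := hZ2 (j / k) l
        have : (-(3 * N) : ℝ) ≤ a l + Z (j / k) l := by nlinarith [hql l]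
        simp only [Pi.add_apply]
        exact_mod_cast this
      · intro l
        have a1 : (a l : ℝ) ≤ M + 1 := by exact_mod_cast ha.2 l
        have := hZ1 (j / k) l
        have : (a l + Z (j / k) l : ℝ) ≤ 3 * N := by nlinarith [hql l]
        simp only [Pi.add_apply]
        exact_mod_cast this
    · intro v hvB hv
      simp only [hBig, Finset.mem_Icc, Pi.le_def] at hvB
      have hpK : ((0:ℝ), fun l => (v l : ℝ) / N) ∈ K := by
        refine ⟨by simp, ?_, fun j hj => ?_⟩
        · rw [pi_norm_le_iff_of_nonneg (by norm_num)]
          intro l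
          have a1 : (-(3 * N) : ℝ) ≤ v l := by exact_mod_cast hvB.1 l
          have a2 : (v l : ℝ) ≤ 3 * N := by exact_mod_cast hvB.2 l
          simp only
          rw [Real.norm_eq_abs, abs_le]
          constructor
          · rw [le_div_iff₀ hN0]; linarith
          · rw [div_le_iff₀ hN0]; linarith
        · simp only [zero_add]
          have hl : ∃ l, M + 1 < v l - Z (j / k) l ∨ v l - Z (j / k) l < - (M + 1) := by
            by_contra hn
            push Not at hn
            apply hv
            simp only [Finset.mem_biUnion, Finset.mem_range, hS, Finset.mem_image]
            refine ⟨j, hj, v - Z (j / k), ?_, by simp⟩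
            simp only [hA, Finset.mem_Icc, Pi.le_def]
            exact ⟨fun l => (hn l).2, fun l => (hn l).1⟩
          obtain ⟨l, hl⟩ := hl
          refine le_trans ?_ (norm_le_pi_norm _ l)
          simp only [Pi.sub_apply]
          have e : (v l : ℝ) / N - q (j / k) l = (v l - N * q (j / k) l) / N := by
            field_simp
          rw [e, Real.norm_eq_abs, le_abs]
          have := hZ1 (j / k) l
          have := hZ2 (j / k) l
          rcases hl with hl | hl
          · left
            have : (M + 1 : ℝ) < v l - Z (j / k) l := by exact_mod_cast hl
            rw [le_div_iff₀ hN0]; nlinarith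
          · right
            have : (v l - Z (j / k) l : ℝ) < - (M + 1) := by exact_mod_cast hl
            rw [← neg_div, le_div_iff₀ hN0]; nlinarith
      have : ∀ σ, kfull w0 v σ = 0 := by
        intro σ
        refine noFull _ hpK w0 v σ fun i => ?_
        refine ⟨(0, fun l => (kvert v σ i l : ℝ) / N), ?_, rfl⟩
        rw [Prod.dist_eq, dist_self]
        refine max_lt hη ?_
        rw [dist_pi_lt_iff hη]
        intro l
        have hb := kvert_bd v σ i l
        have h1 : (v l : ℝ) ≤ kvert v σ i l := by exact_mod_cast hb.1
        have h2 : (kvert v σ i l : ℝ) ≤ v l + 1 := by exact_mod_cast hb.2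
        simp only
        rw [Real.dist_eq, ← sub_div, abs_lt]
        refine ⟨lt_of_lt_of_le (neg_lt_zero.2 hη) (div_nonneg (by linarith) hN0.le), ?_⟩
        have : ((kvert v σ i l : ℝ) - v l) / N ≤ 4 / N :=
          div_le_div_of_nonneg_right (by linarith) hN0.le
        linarith
      simp [ksum, this]
  rw [hsumS, Finset.sum_biUnion] at htot
  · have : ∀ j ∈ Finset.range k, ∑ v ∈ S j, ksum w0 v = ∑ v ∈ A, ksum (u 0) v := by
      intro j hj
      rw [Finset.mem_range] at hj
      rw [← hchain j hj]
      simp only [hS]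
      rw [Finset.sum_image (fun a _ b _ h => add_right_cancel h)]
      exact Finset.sum_congr rfl fun v _ => hus j v
    rw [Finset.sum_congr rfl this] at htot
    simp only [Finset.sum_const, Finset.card_range, nsmul_eq_mul] at htot
    rw [← htot] at hst2
    have := isUnit_of_mul_isUnit_left hst2
    rw [Int.isUnit_iff] at this
    omega
  · intro i hi j hj hij
    simp only [Finset.coe_range, Set.mem_Iio] at hi hj
    rcases lt_or_gt_of_ne hij with h | h
    · exact hdisj i j h hj
    · exact (hdisj j i h hi).symm

def circ (m : ℕ) (s : ℝ) : Fin (m + 2) → ℝ :=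
  Fin.cons (Real.cos (2 * Real.pi * s) / 2) (Fin.cons (Real.sin (2 * Real.pi * s) / 2) 0)

lemma circ_cont (m : ℕ) : Continuous (circ m) := by
  refine continuous_pi fun l => ?_
  refine Fin.cases ?_ (fun l => Fin.cases ?_ (fun l => ?_) l) l
  · simp only [circ, Fin.cons_zero]; fun_prop
  · simp only [circ, Fin.cons_succ, Fin.cons_zero]; fun_prop
  · simp only [circ, Fin.cons_succ, Pi.zero_apply]; fun_prop

lemma circ_norm (m : ℕ) (s : ℝ) : ‖(WithLp.toLp 2 (circ m s) : E (m + 2))‖ = 1 / 2 := by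
  have h : ‖(WithLp.toLp 2 (circ m s) : E (m + 2))‖ ^ 2 = (1 / 2) ^ 2 := by
    rw [EuclideanSpace.real_norm_sq_eq]
    simp only [circ, Fin.sum_univ_succ, Fin.cons_zero, Fin.cons_succ]
    simp only [Pi.zero_apply]
    have := Real.cos_sq_add_sin_sq (2 * Real.pi * s)
    simp
    nlinarith
  exact (pow_left_inj₀ (norm_nonneg _) (by norm_num) two_ne_zero).1 h

lemma circ_inj (m : ℕ) (a b : ℝ) (h : circ m a = circ m b) : ∃ n : ℤ, a - b = n := by
  have h1 : Real.cos (2 * Real.pi * a) = Real.cos (2 * Real.pi * b) := by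
    have := congrFun h 0
    simp only [circ, Fin.cons_zero] at this
    linarith
  have h2 : Real.sin (2 * Real.pi * a) = Real.sin (2 * Real.pi * b) := by
    have := congrFun h (Fin.succ 0)
    simp only [circ, Fin.cons_zero, Fin.cons_succ] at this
    linarith
  have := Real.Angle.cos_sin_inj h1 h2
  obtain ⟨n, hn⟩ := Real.Angle.angle_eq_iff_two_pi_dvd_sub.1 this
  refine ⟨n, ?_⟩
  have hp : (2 * Real.pi) ≠ 0 := by positivity
  apply mul_left_cancel₀ hp
  linarith

lemma circ_per (m : ℕ) (a : ℝ) : circ m (a + 1) = circ m a := by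
  simp [circ, mul_add]

lemma sup_le_euclid {m : ℕ} (x : Fin m → ℝ) : ‖x‖ ≤ ‖(WithLp.toLp 2 x : E m)‖ := by
  rw [pi_norm_le_iff_of_nonneg (norm_nonneg _)]
  intro i
  exact PiLp.norm_apply_le (WithLp.toLp 2 x : E m) i

/-- The rule associated to a section. -/
lemma exists_rule (m n : ℕ) (sbar : ConfQ m n → TotQ m n) (hc : Continuous sbar)
    (hs : ∀ q, gbar m n (sbar q) = q) :
    ∃ f : ↥(PConf m n) → E m, Continuous f ∧ (∀ p, ‖f p‖ ≤ 1) ∧ (∀ p i, f p ≠ p.1 i) ∧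
      ∀ (p p' : ↥(PConf m n)) (τ : Equiv.Perm (Fin n)), p'.1 = p.1 ∘ τ → f p' = f p := by
  have hl : ∀ a b : ↥(TotConf m n),
      (MulAction.orbitRel (Equiv.Perm (Fin n)) ↥(TotConf m n)) a b → a.1.1 = b.1.1 := by
    rintro a b ⟨τ, rfl⟩
    rfl
  let F : TotQ m n → E m := Quotient.lift (fun x : ↥(TotConf m n) => x.1.1) hl
  have hF : Continuous F := Continuous.quotient_lift (by fun_prop) hl
  have hsp : ∀ p : ↥(PConf m n), ∃ x : ↥(TotConf m n), ∃ τ : Equiv.Perm (Fin n),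
      F (sbar ⟦p⟧) = x.1.1 ∧ p.1 = x.1.2 ∘ τ := by
    intro p
    obtain ⟨x, hx⟩ := Quotient.exists_rep (sbar ⟦p⟧)
    have h := hs ⟦p⟧
    rw [← hx] at h
    have h2 : (⟦forget m n x⟧ : ConfQ m n) = ⟦p⟧ := h
    obtain ⟨τ, hτ⟩ := Quotient.exact h2.symm
    refine ⟨x, (τ⁻¹ : Equiv.Perm (Fin n)), by rw [← hx]; rfl, ?_⟩
    rw [← hτ]
    rfl
  refine ⟨fun p => F (sbar ⟦p⟧), hF.comp (hc.comp continuous_quotient_mk'), ?_, ?_, ?_⟩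
  · intro p
    obtain ⟨x, τ, h, _⟩ := hsp p
    simp only [h]
    simpa [Dball] using x.2.1
  · intro p i
    obtain ⟨x, τ, h, h'⟩ := hsp p
    simp only [h, h']
    exact x.2.2.2.2 _
  · intro p p' τ h
    have : (⟦p'⟧ : ConfQ m n) = ⟦p⟧ := by
      apply Quotient.sound
      refine ⟨τ⁻¹, Subtype.ext ?_⟩
      rw [h]
      show p.1 ∘ ⇑(τ⁻¹)⁻¹ = _
      rw [inv_inv]
    simp only [this]

theorem no_rule (m k : ℕ) (hk : 2 ≤ k) (f : ↥(PConf (m + 2) (k + 1)) → E (m + 2))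
    (hf : Continuous f) (hf1 : ∀ p, ‖f p‖ ≤ 1) (hf2 : ∀ p i, f p ≠ p.1 i)
    (hf3 : ∀ (p p' : ↥(PConf (m + 2) (k + 1))) (τ : Equiv.Perm (Fin (k + 1))),
      p'.1 = p.1 ∘ τ → f p' = f p) : False := by
  classical
  have hk0 : (0:ℝ) < k := by exact_mod_cast (by omega : 0 < k)
  let e : (Fin (m+2) → ℝ) → E (m+2) := fun x => WithLp.toLp 2 x
  have he : Continuous e := PiLp.continuous_toLp 2 _
  have hei : ∀ x y, e x = e y → x = y := fun x y h => by simpa [e] using h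
  let y : (Fin (m+2) → ℝ) → E (m+2) := fun x => (max 1 ‖e x‖)⁻¹ • e x
  have hmax : ∀ x, (0:ℝ) < max 1 ‖e x‖ := fun x => lt_max_of_lt_left one_pos
  have hy : Continuous y := by
    refine Continuous.smul (Continuous.inv₀ (by fun_prop) fun x => (hmax x).ne') he
  have hyn : ∀ x, ‖y x‖ ≤ 1 := by
    intro x
    simp only [y, norm_smul, norm_inv, Real.norm_eq_abs, abs_of_pos (hmax x)]
    rw [inv_mul_le_iff₀ (hmax x), mul_one]
    exact le_max_right _ _
  have hy1 : ∀ x, ‖e x‖ ≤ 1 → y x = e x := by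
    intro x hx; simp [y, max_eq_left hx]
  have hy2 : ∀ x, 1 < ‖e x‖ → ‖y x‖ = 1 := by
    intro x hx
    simp only [y, norm_smul, norm_inv, Real.norm_eq_abs, abs_of_pos (hmax x)]
    rw [max_eq_right hx.le, inv_mul_cancel₀ (by linarith)]
  let c : ℝ → (Fin (m+2) → ℝ) → Fin (k+1) → E (m+2) := fun s x =>
    Fin.cons (y x) (fun j : Fin k => e (circ m (s + (j : ℕ) / k)))
  have hcc : Continuous (fun p : ℝ × (Fin (m+2) → ℝ) => c p.1 p.2) := by
    refine continuous_pi fun i => Fin.cases ?_ (fun i => ?_) i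
    · simp only [c, Fin.cons_zero]; fun_prop
    · simp only [c, Fin.cons_succ]
      exact he.comp ((circ_cont m).comp (by fun_prop))
  let χ : (Fin (m+2) → ℝ) → ℝ := fun x => max 0 (min 1 (2 - ‖e x‖))
  have hχ : Continuous χ := by fun_prop
  have hχ0 : ∀ x, 0 ≤ χ x := fun x => le_max_left _ _
  have hχ1 : ∀ x, χ x ≤ 1 := fun x => max_le zero_le_one (min_le_left _ _)
  let G : ℝ → (Fin (m+2) → ℝ) → (Fin (m+2) → ℝ) := fun s x =>
    if h : c s x ∈ PConf (m+2) (k+1) then χ x • (f ⟨c s x, h⟩).ofLp - x else -x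
  let U : Set (ℝ × (Fin (m+2) → ℝ)) := {p | ∀ j : ℕ, j < k → p.2 ≠ circ m (p.1 + j / k)}
  have hUo : IsOpen U := by
    have : U = ⋂ j ∈ Finset.range k, {p : ℝ × (Fin (m+2) → ℝ) | p.2 ≠ circ m (p.1 + j / k)} := by
      ext p; simp [U]
    rw [this]
    refine isOpen_biInter_finset fun j _ => ?_
    exact isOpen_ne_fun continuous_snd ((circ_cont m).comp (by fun_prop))
  have hcU : ∀ p ∈ U, c p.1 p.2 ∈ PConf (m+2) (k+1) := by
    rintro ⟨s, x⟩ hp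
    refine ⟨fun i => ?_, ?_⟩
    · refine Fin.cases ?_ (fun i => ?_) i
      · simpa [c, Dball] using hyn x
      · have := circ_norm m (s + (i:ℕ) / k)
        simp only [c, Dball, Fin.cons_succ, mem_closedBall, dist_zero_right, e, this]
        norm_num
    · simp only [c]
      rw [Fin.cons_injective_iff]
      constructor
      · rintro ⟨j, hj⟩
        simp only at hj
        rcases le_or_gt ‖e x‖ 1 with h | h
        · rw [hy1 x h] at hj
          exact hp j j.2 (hei _ _ hj).symm
        · have h1 := hy2 x h
          rw [← hj] at h1
          simp only [e, circ_norm] at h1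
          norm_num at h1
      · intro i j hij
        obtain ⟨n, hn⟩ := circ_inj m _ _ (hei _ _ hij)
        have h1 : ((i:ℕ) : ℝ) - (j:ℕ) = n * k := by
          have : ((i:ℕ) : ℝ) / k - (j:ℕ) / k = n := by linarith
          field_simp at this
          linarith
        have h2 : ((i:ℕ) : ℤ) - (j:ℕ) = n * k := by exact_mod_cast h1
        have hi := i.2
        have hj := j.2
        apply Fin.ext
        have hn0 : n = 0 := by
          by_contra hne
          rcases lt_or_gt_of_ne hne with h | h
          · nlinarith
          · nlinarith
        subst hn0
        omega
  refine degree_core (m := m + 2) (k := k) (by omega) hk (circ m) (circ_cont m) ?_ ?_ G ?_ ?_ ?_ ?_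
  · intro s j hj0 hj h
    obtain ⟨n, hn⟩ := circ_inj m _ _ h
    have h1 : (j : ℝ) = n * k := by
      have : (j : ℝ) / k = n := by linarith
      field_simp at this
      linarith
    have h2 : (j : ℤ) = n * k := by exact_mod_cast h1
    have : 0 < n := by
      by_contra hc
      nlinarith
    nlinarith
  · intro s
    refine (sup_le_euclid _).trans ?_
    rw [circ_norm]; norm_num
  · intro p hp
    have : ContinuousOn (fun p : ℝ × (Fin (m+2) → ℝ) => G p.1 p.2) U := by
      rw [continuousOn_iff_continuous_domRestrict]
      have e1 : U.domRestrict (fun p : ℝ × (Fin (m+2) → ℝ) => G p.1 p.2) = fun p : U =>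
          χ p.1.2 • (f ⟨c p.1.1 p.1.2, hcU p.1 p.2⟩).ofLp - p.1.2 := by
        funext p
        simp only [Set.domRestrict_apply, G, dif_pos (hcU p.1 p.2)]
      rw [e1]
      have hc1 : Continuous (fun p : U => (⟨c p.1.1 p.1.2, hcU p.1 p.2⟩ : ↥(PConf (m+2) (k+1)))) :=
        Continuous.subtype_mk (hcc.comp continuous_subtype_val) _
      have hc2 : Continuous (fun p : U => (f ⟨c p.1.1 p.1.2, hcU p.1 p.2⟩).ofLp) :=
        (PiLp.continuous_ofLp 2 _).comp (hf.comp hc1)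
      exact ((hχ.comp (continuous_snd.comp continuous_subtype_val)).smul hc2).sub
        (continuous_snd.comp continuous_subtype_val)
    exact this.continuousAt (hUo.mem_nhds hp)
  · intro p hp h0
    have hpU : p ∈ U := hp
    simp only [G, dif_pos (hcU p hpU)] at h0
    have h1 : χ p.2 • f ⟨c p.1 p.2, hcU p hpU⟩ = e p.2 := by
      exact congrArg (WithLp.toLp 2) (sub_eq_zero.1 h0)
    rcases le_or_gt ‖e p.2‖ 1 with h | h
    · have hx1 : χ p.2 = 1 := by
        simp only [χ]
        rw [min_eq_left (by linarith), max_eq_right zero_le_one]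
      rw [hx1, one_smul] at h1
      exact hf2 _ 0 (h1.trans (hy1 _ h).symm)
    · have h2 : ‖e p.2‖ ≤ 1 := by
        rw [← h1, norm_smul, Real.norm_eq_abs, abs_of_nonneg (hχ0 _)]
        exact mul_le_one₀ (hχ1 _) (norm_nonneg _) (hf1 _)
      linarith
  · intro s x
    let τ : Equiv.Perm (Fin (k+1)) := Equiv.Perm.decomposeFin.symm (0, finRotate k)
    have hτ : c (s + 1 / k) x = c s x ∘ τ := by
      funext i
      refine Fin.cases ?_ (fun i => ?_) i
      · simp [c, τ]
      · simp only [c, τ, comp_apply, Equiv.Perm.decomposeFin_symm_apply_succ, Equiv.swap_self,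
          Equiv.refl_apply, Fin.cons_succ]
        congr 1
        obtain ⟨k, rfl⟩ : ∃ k', k = k' + 1 := ⟨k - 1, by omega⟩
        by_cases hi : i = Fin.last k
        · subst hi
          rw [finRotate_last]
          have : s + 1 / ((k + 1 : ℕ) : ℝ) + ((Fin.last k : Fin (k+1)) : ℕ) / ((k + 1 : ℕ) : ℝ)
              = s + 1 := by
            rw [Fin.val_last]
            push_cast at hk0 ⊢
            field_simp
            ring
          rw [this, circ_per]
          simp
        · rw [coe_finRotate_of_ne_last hi]
          congr 1
          push_cast
          ring
    simp only [G]
    by_cases h : c s x ∈ PConf (m+2) (k+1)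
    · have h' : c (s + 1 / k) x ∈ PConf (m+2) (k+1) := by
        rw [hτ]
        exact ⟨fun i => h.1 _, h.2.comp τ.injective⟩
      rw [dif_pos h, dif_pos h', hf3 ⟨c s x, h⟩ ⟨c (s + 1 / k) x, h'⟩ τ hτ]
    · have h' : c (s + 1 / k) x ∉ PConf (m+2) (k+1) := by
        intro h'
        apply h
        have e2 : c s x = c (s + 1 / k) x ∘ (τ⁻¹ : Equiv.Perm (Fin (k+1))) := by
          rw [hτ]; funext i; simp
        rw [e2]
        exact ⟨fun i => h'.1 _, h'.2.comp (Equiv.injective _)⟩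
      rw [dif_neg h, dif_neg h']
  · intro s x hx
    have h2 : 2 ≤ ‖e x‖ := hx.trans (sup_le_euclid x)
    have hx0 : χ x = 0 := by
      simp only [χ]
      exact max_eq_left ((min_le_right _ _).trans (by linarith))
    simp only [G, hx0]
    split_ifs <;> simp

/-- Main negative theorem: for `m ≥ 2` and `n ≥ 3` the map
`ḡ : PConfₙ₊₁(D^m)/Σₙ → Confₙ(D^m)` forgetting the added point admits no continuous
section; i.e. there is no continuous rule adding a new distinct point to every
unordered configuration of `n` points in the closed ball. -/
theorem no_unordered_section (m n : ℕ) (hm : 2 ≤ m) (hn : 3 ≤ n) :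
    ¬ ∃ sbar : ConfQ m n → TotQ m n,
        Continuous sbar ∧ ∀ q, gbar m n (sbar q) = q := by
  rintro ⟨sbar, hc, hs⟩
  obtain ⟨f, h1, h2, h3, h4⟩ := exists_rule m n sbar hc hs
  obtain ⟨m, rfl⟩ : ∃ m', m = m' + 2 := ⟨m - 2, by omega⟩
  obtain ⟨k, rfl⟩ : ∃ k, n = k + 1 := ⟨n - 1, by omega⟩
  exact no_rule m k (by omega) f h1 h2 h3 h4
end
end

section
/- For m ≥ 2 and n ≥ 3, every continuous map f : Confₙ(D^m) → D^m has a 'fixed point' in the sense that there exists an n-element subset S = {p₁,…,pₙ} ⊂ D^m with f(S) ∈ S. -/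
open Metric Function

noncomputable section

def vtx {d : ℕ} (x : Fin d → ℤ) (π : Equiv.Perm (Fin d)) (j : ℕ) : Fin d → ℤ :=
  fun a => x a + if ((π.symm a : Fin d) : ℕ) < j then 1 else 0

def lvec {d : ℕ} (l : Fin (d+1)) : Fin d → ℤ := fun i => if l = i.succ then 1 else 0

def smat {d : ℕ} (ℓ : (Fin d → ℤ) → Fin (d+1)) (x : Fin d → ℤ) (π : Equiv.Perm (Fin d)) :
    Matrix (Fin (d+1)) (Fin (d+1)) ℤ := fun j => Fin.cons 1 (lvec (ℓ (vtx x π j)))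

def Cub {d : ℕ} (ℓ : (Fin d → ℤ) → Fin (d+1)) (x : Fin d → ℤ) : ℤ :=
  ∑ π : Equiv.Perm (Fin d), (Equiv.Perm.sign π : ℤ) * (smat ℓ x π).det

def fac {d : ℕ} (ℓ : (Fin d → ℤ) → Fin (d+1)) (x : Fin d → ℤ) (π : Equiv.Perm (Fin d)) : ℤ :=
  (Equiv.Perm.sign π : ℤ) * Matrix.det (fun i : Fin d => lvec (ℓ (vtx x π i)))

theorem vtx_rot {d : ℕ} (x : Fin (d+1) → ℤ) (π : Equiv.Perm (Fin (d+1))) (i : Fin (d+1)) :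
    vtx x π (i.succ : Fin (d+2)) = vtx (x + Pi.single (π 0) 1) (π * finRotate (d+1)) i := by
  funext a
  obtain ⟨b, rfl⟩ := π.surjective a
  have hs : (π * finRotate (d+1)).symm (π b) = (finRotate (d+1)).symm b := by
    rw [Equiv.symm_apply_eq]; simp
  simp only [vtx, hs, Equiv.symm_apply_apply, Pi.add_apply]
  obtain ⟨c, rfl⟩ := (finRotate (d+1)).surjective b
  simp only [Equiv.symm_apply_apply]
  rcases eq_or_ne c (Fin.last d) with rfl | hc
  · rw [finRotate_last]
    have : ¬ ((Fin.last d : Fin (d+1)) : ℕ) < i := by simp; omega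
    rw [if_neg this]; simp
  · have h1 : ((finRotate (d+1) c : Fin (d+1)) : ℕ) = c + 1 := coe_finRotate_of_ne_last hc
    have h2 : π (finRotate (d+1) c) ≠ π 0 := by
      intro h
      have := π.injective h
      rw [this] at h1; simp at h1
    rw [Pi.single_eq_of_ne h2, h1]
    simp

theorem vtx_swap {d : ℕ} (x : Fin (d+1) → ℤ) (π : Equiv.Perm (Fin (d+1))) (j : Fin d) (i : ℕ)
    (hi : i ≠ (j : ℕ) + 1) :
    vtx x (π * Equiv.swap j.castSucc j.succ) i = vtx x π i := by
  funext a
  obtain ⟨b, rfl⟩ := π.surjective a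
  have hs : (π * Equiv.swap j.castSucc j.succ).symm (π b) = Equiv.swap j.castSucc j.succ b := by
    rw [Equiv.symm_apply_eq]; simp
  simp only [vtx, hs, Equiv.symm_apply_apply]
  congr 2
  rw [Equiv.swap_apply_def]
  split_ifs with h1 h2
  · subst h1; simp; omega
  · subst h2; simp; omega
  · rfl

theorem mid_zero {d : ℕ} (ℓ : (Fin (d+1) → ℤ) → Fin (d+2)) (x : Fin (d+1) → ℤ) (j : Fin d) :
    ∑ π : Equiv.Perm (Fin (d+1)), (Equiv.Perm.sign π : ℤ) *
      Matrix.det (fun i : Fin (d+1) => lvec (ℓ (vtx x π ((j.castSucc.succ : Fin (d+2)).succAbove i : Fin (d+2))))) = 0 := by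
  have h := Equiv.sum_comp (Equiv.mulRight (Equiv.swap j.castSucc j.succ))
    (fun π : Equiv.Perm (Fin (d+1)) => (Equiv.Perm.sign π : ℤ) *
      Matrix.det (fun i : Fin (d+1) => lvec (ℓ (vtx x π ((j.castSucc.succ : Fin (d+2)).succAbove i : Fin (d+2))))))
  have hne : j.castSucc ≠ j.succ := by
    intro h; have := congrArg Fin.val h; simp at this
  have h2 : ∀ π : Equiv.Perm (Fin (d+1)), ∀ i : Fin (d+1),
      vtx x (π * Equiv.swap j.castSucc j.succ) ((j.castSucc.succ : Fin (d+2)).succAbove i : Fin (d+2))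
      = vtx x π ((j.castSucc.succ : Fin (d+2)).succAbove i : Fin (d+2)) := by
    intro π i
    apply vtx_swap
    intro h
    have := Fin.succAbove_ne (j.castSucc.succ : Fin (d+2)) i
    apply this; ext; simpa using h
  simp only [Equiv.coe_mulRight, h2, Equiv.Perm.sign_mul, Equiv.Perm.sign_swap hne] at h
  simp only [mul_neg, mul_one, Units.val_neg, neg_mul, Finset.sum_neg_distrib] at h
  omega

theorem cub_eq {d : ℕ} (ℓ : (Fin (d+1) → ℤ) → Fin (d+2)) (x : Fin (d+1) → ℤ) :
    Cub ℓ x = (-1)^d * ∑ π : Equiv.Perm (Fin (d+1)),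
      (fac ℓ (x + Pi.single (π (Fin.last d)) 1) π - fac ℓ x π) := by
  have hdet : ∀ π, (smat ℓ x π).det = ∑ j : Fin (d+2), (-1)^(j:ℕ) *
      Matrix.det (fun i : Fin (d+1) => lvec (ℓ (vtx x π (j.succAbove i : Fin (d+2))))) := by
    intro π
    rw [Matrix.det_succ_column_zero]
    refine Finset.sum_congr rfl fun j _ => ?_
    have : (smat ℓ x π) j 0 = 1 := rfl
    rw [this, mul_one]; rfl
  unfold Cub
  simp only [hdet, Finset.mul_sum]
  rw [Finset.sum_comm, Fin.sum_univ_succ, Fin.sum_univ_castSucc]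
  have hmid : ∀ j : Fin d, ∑ π : Equiv.Perm (Fin (d+1)), (Equiv.Perm.sign π : ℤ) *
      ((-1)^((j.castSucc.succ : Fin (d+2)):ℕ) * Matrix.det (fun i : Fin (d+1) => lvec (ℓ (vtx x π ((j.castSucc.succ : Fin (d+2)).succAbove i : Fin (d+2)))))) = 0 := by
    intro j
    rw [← mul_zero ((-1 : ℤ)^((j.castSucc.succ : Fin (d+2)):ℕ)), ← mid_zero ℓ x j, Finset.mul_sum]
    exact Finset.sum_congr rfl fun π _ => by ring
  simp only [hmid, Finset.sum_const_zero, zero_add]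
  have h0 : ∑ π : Equiv.Perm (Fin (d+1)), (-1:ℤ)^d * fac ℓ (x + Pi.single (π (Fin.last d)) 1) π =
      ∑ π : Equiv.Perm (Fin (d+1)), (Equiv.Perm.sign π : ℤ) *
      ((-1)^((0 : Fin (d+2)):ℕ) * Matrix.det (fun i : Fin (d+1) => lvec (ℓ (vtx x π ((0 : Fin (d+2)).succAbove i : Fin (d+2)))))) := by
    rw [← Equiv.sum_comp (Equiv.mulRight (finRotate (d+1)))]
    refine Finset.sum_congr rfl fun π _ => ?_
    simp only [Equiv.coe_mulRight, fac, Equiv.Perm.coe_mul, Function.comp_apply, finRotate_last,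
      Equiv.Perm.sign_mul, sign_finRotate, Fin.succAbove_zero, vtx_rot]
    have : ((-1:ℤ)^d) * (-1)^d = 1 := by rw [← mul_pow]; simp
    push_cast
    simp only [Fin.val_zero, pow_zero, one_mul]
    linear_combination ((Equiv.Perm.sign π : ℤ) * Matrix.det (fun i : Fin (d+1) => lvec (ℓ (vtx (x + Pi.single (π 0) 1) (π * finRotate (d+1)) i)))) * this
  rw [← h0, ← Finset.sum_add_distrib]
  refine Finset.sum_congr rfl fun π _ => ?_
  have : ((Fin.last d).succ : Fin (d+2)) = Fin.last (d+1) := rfl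
  rw [this]
  simp only [Fin.succAbove_last, fac, Fin.val_last, Fin.val_castSucc]
  ring

def inCube {d : ℕ} (x y : Fin d → ℤ) : Prop := ∀ a, x a ≤ y a ∧ y a ≤ x a + 1

theorem vtx_inCube {d : ℕ} (x : Fin d → ℤ) (π : Equiv.Perm (Fin d)) (j : ℕ) :
    inCube x (vtx x π j) := by
  intro a; unfold vtx; split_ifs <;> constructor <;> omega

theorem Cub_congr {d : ℕ} {ℓ ℓ' : (Fin d → ℤ) → Fin (d+1)} {x : Fin d → ℤ}
    (h : ∀ y, inCube x y → ℓ y = ℓ' y) : Cub ℓ x = Cub ℓ' x := by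
  unfold Cub smat
  simp only [h _ (vtx_inCube x _ _)]

theorem fac_congr {d : ℕ} {ℓ ℓ' : (Fin d → ℤ) → Fin (d+1)} {x : Fin d → ℤ} (π : Equiv.Perm (Fin d))
    (h : ∀ y, inCube x y → ℓ y = ℓ' y) : fac ℓ x π = fac ℓ' x π := by
  unfold fac
  simp only [h _ (vtx_inCube x _ _)]

theorem Cub_trans {d : ℕ} (ℓ : (Fin d → ℤ) → Fin (d+1)) (b x : Fin d → ℤ) :
    Cub (fun u => ℓ (b + u)) x = Cub ℓ (b + x) := by
  have : ∀ π j, vtx (b + x) π j = b + vtx x π j := by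
    intro π j; funext a; simp [vtx, add_assoc]
  unfold Cub smat
  simp only [this]

theorem Cub_complete {d : ℕ} {ℓ : (Fin d → ℤ) → Fin (d+1)} {x : Fin d → ℤ}
    (h : Cub ℓ x ≠ 0) (l : Fin (d+1)) : ∃ y, inCube x y ∧ ℓ y = l := by
  obtain ⟨π, -, hπ⟩ := Finset.exists_ne_zero_of_sum_ne_zero h
  have hdet := right_ne_zero_of_mul hπ
  have hinj : Function.Injective (fun j : Fin (d+1) => ℓ (vtx x π j)) := by
    intro i j hij
    by_contra hne
    apply hdet
    apply Matrix.det_zero_of_row_eq hne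
    simp only at hij
    simp only [smat, hij]
  obtain ⟨j, hj⟩ := Finite.injective_iff_surjective.1 hinj l
  exact ⟨_, vtx_inCube x π j, hj⟩

theorem supp_shift {d : ℕ} (g : (Fin d → ℤ) → ℤ) (c : Fin d → ℤ) (hg : (Function.support g).Finite) :
    (Function.support fun x => g (x + c)).Finite :=
  hg.preimage (f := fun x : Fin d → ℤ => x + c) (add_left_injective c).injOn

theorem factA {d : ℕ} {ℓ ℓ' : (Fin (d+1) → ℤ) → Fin (d+2)} (B : Finset (Fin (d+1) → ℤ))
    (hB : ∀ x y, inCube x y → ℓ y ≠ ℓ' y → x ∈ B) :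
    ∑ x ∈ B, Cub ℓ x = ∑ x ∈ B, Cub ℓ' x := by
  have hz : ∀ x, x ∉ B → Cub ℓ x - Cub ℓ' x = 0 := by
    intro x hx
    rw [sub_eq_zero]
    apply Cub_congr
    intro y hy
    by_contra hne
    exact hx (hB x y hy hne)
  have hfz : ∀ π x, x ∉ B → fac ℓ x π - fac ℓ' x π = 0 := by
    intro π x hx
    rw [sub_eq_zero]
    apply fac_congr
    intro y hy
    by_contra hne
    exact hx (hB x y hy hne)
  rw [← sub_eq_zero, ← Finset.sum_sub_distrib]
  have h1 : ∑ x ∈ B, (Cub ℓ x - Cub ℓ' x) = ∑ᶠ x, (Cub ℓ x - Cub ℓ' x) := by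
    rw [finsum_eq_sum_of_support_subset]
    intro x hx
    by_contra hne
    exact hx (hz x hne)
  have hfin : ∀ π : Equiv.Perm (Fin (d+1)), (Function.support fun x => fac ℓ x π - fac ℓ' x π).Finite := by
    intro π
    apply B.finite_toSet.subset
    intro x hx
    by_contra hne
    exact hx (hfz π x hne)
  have hfin2 : ∀ π : Equiv.Perm (Fin (d+1)), (Function.support fun x : Fin (d+1) → ℤ =>
      fac ℓ (x + Pi.single (π (Fin.last d)) 1) π - fac ℓ' (x + Pi.single (π (Fin.last d)) 1) π).Finite := by
    intro π
    exact supp_shift (fun x => fac ℓ x π - fac ℓ' x π) _ (hfin π)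
  rw [h1]
  have h2 : ∀ x, Cub ℓ x - Cub ℓ' x = ∑ π : Equiv.Perm (Fin (d+1)), (-1)^d *
      ((fac ℓ (x + Pi.single (π (Fin.last d)) 1) π - fac ℓ' (x + Pi.single (π (Fin.last d)) 1) π)
       - (fac ℓ x π - fac ℓ' x π)) := by
    intro x
    rw [cub_eq, cub_eq, ← mul_sub, ← Finset.sum_sub_distrib, Finset.mul_sum]
    exact Finset.sum_congr rfl fun π _ => by ring
  simp only [h2]
  rw [finsum_sum_comm]
  · apply Finset.sum_eq_zero
    intro π _
    rw [← mul_finsum, finsum_sub_distrib (hfin2 π) (hfin π)]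
    · have := finsum_comp_equiv (Equiv.addRight (Pi.single (π (Fin.last d)) (1:ℤ)))
        (f := fun x => fac ℓ x π - fac ℓ' x π)
      simp only [Equiv.coe_addRight] at this
      rw [this]; simp
  · intro π _
    refine ((hfin2 π).union (hfin π)).subset ?_
    refine subset_trans ?_ (Function.support_sub _ _)
    intro x hx
    exact right_ne_zero_of_mul hx

theorem homLemma {d : ℕ} {ℓ ℓ' : (Fin (d+1) → ℤ) → Fin (d+2)} (B : Finset (Fin (d+1) → ℤ))
    (S : Set (Fin (d+1) → ℤ))
    (hB : ∀ x y, inCube x y → y ∈ S → x ∈ B)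
    (hmix : ∀ x ∈ B, ∀ y, inCube x y → y ∉ S → ∃ l, ∀ z, inCube x z → ℓ z ≠ l ∧ ℓ' z ≠ l) :
    ∑ x ∈ B, Cub ℓ x = ∑ x ∈ B, Cub ℓ' x := by
  classical
  have h1 : ∑ x ∈ B, Cub ℓ x = ∑ x ∈ B, Cub (fun y => if y ∈ S then ℓ' y else ℓ y) x := by
    apply factA
    intro x y hxy hne
    apply hB x y hxy
    by_contra hy
    simp [hy] at hne
  rw [h1]
  refine Finset.sum_congr rfl fun x hx => ?_
  by_cases hc : ∀ y, inCube x y → y ∈ S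
  · apply Cub_congr
    intro y hy
    simp [hc y hy]
  · push Not at hc
    obtain ⟨y, hy, hyS⟩ := hc
    obtain ⟨l, hl⟩ := hmix x hx y hy hyS
    have e1 : Cub (fun y => if y ∈ S then ℓ' y else ℓ y) x = 0 := by
      by_contra hne
      obtain ⟨z, hz, hzl⟩ := Cub_complete hne l
      change (if z ∈ S then ℓ' z else ℓ z) = l at hzl
      split_ifs at hzl
      · exact (hl z hz).2 hzl
      · exact (hl z hz).1 hzl
    have e2 : Cub ℓ' x = 0 := by
      by_contra hne
      obtain ⟨z, hz, hzl⟩ := Cub_complete hne l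
      exact (hl z hz).2 hzl
    rw [e1, e2]
open Classical in
def lab {d : ℕ} (y : Fin d → ℝ) : Fin (d+1) :=
  if h : ∃ i, 0 < y i ∧ ∀ j < i, ¬ 0 < y j then (Classical.choose h).succ else 0

theorem lab_zero {d : ℕ} {y : Fin d → ℝ} (h : lab y = 0) : ∀ i, y i ≤ 0 := by
  classical
  unfold lab at h
  split_ifs at h with h1
  · exact absurd h (Fin.succ_ne_zero _)
  · by_contra hc
    push Not at hc
    obtain ⟨i, hi⟩ := hc
    apply h1
    obtain ⟨k, hk, hmin⟩ := WellFounded.has_min (wellFounded_lt (α := Fin d)) {i | 0 < y i} ⟨i, hi⟩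
    exact ⟨k, hk, fun j hj hj' => hmin j hj' hj⟩

theorem lab_succ {d : ℕ} {y : Fin d → ℝ} {i : Fin d} (h : lab y = i.succ) : 0 < y i := by
  classical
  unfold lab at h
  split_ifs at h with h1
  · have := Fin.succ_injective _ h
    rw [← this]
    exact (Classical.choose_spec h1).1
  · exact absurd h.symm (Fin.succ_ne_zero _)

theorem lab_eq_zero {d : ℕ} {y : Fin d → ℝ} (h : ∀ i, y i ≤ 0) : lab y = 0 := by
  unfold lab
  rw [dif_neg]
  rintro ⟨i, hi, -⟩
  exact absurd hi (not_lt.2 (h i))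

theorem lab_eq_succ {d : ℕ} {y : Fin d → ℝ} {i : Fin d} (h : 0 < y i) (h2 : ∀ j < i, y j ≤ 0) :
    lab y = i.succ := by
  have h1 : ∃ i, 0 < y i ∧ ∀ j < i, ¬ 0 < y j := ⟨i, h, fun j hj => not_lt.2 (h2 j hj)⟩
  unfold lab
  rw [dif_pos h1]
  congr 1
  have := Classical.choose_spec h1
  rcases lt_trichotomy (Classical.choose h1) i with hl | hl | hl
  · exact absurd this.1 (not_lt.2 (h2 _ hl))
  · exact hl
  · exact absurd h (this.2 _ hl)

/-- points that are close to each other and away from zero are not completely labelled -/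
theorem lab_incomplete {d : ℕ} {δ : ℝ} (hδ : 0 < δ) (Y : Set (Fin d → ℝ))
    (hY : ∀ y ∈ Y, δ ≤ ‖y‖) (hYY : ∀ y ∈ Y, ∀ y' ∈ Y, ‖y - y'‖ < δ) :
    ∃ l, ∀ y ∈ Y, lab y ≠ l := by
  by_contra hc
  push Not at hc
  obtain ⟨y, hy, hy0⟩ := hc 0
  have h0 := lab_zero hy0
  have : ‖y‖ < δ := by
    rw [pi_norm_lt_iff hδ]
    intro i
    obtain ⟨y', hy', hi⟩ := hc i.succ
    have hpos := lab_succ hi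
    have h1 : ‖(y' - y) i‖ < δ := lt_of_le_of_lt (norm_le_pi_norm _ i) (hYY y' hy' y hy)
    rw [Real.norm_eq_abs, abs_lt] at *
    simp only [Pi.sub_apply] at h1
    have := h0 i
    constructor <;> linarith
  exact absurd (hY y hy) (not_le.2 this)

def negLab {d : ℕ} (h : ℝ) (x : Fin d → ℤ) : Fin (d+1) := lab (fun a => - (h * (x a : ℝ)))

theorem negLab_eq_zero {d : ℕ} {h : ℝ} (hh : 0 < h) {x : Fin d → ℤ} (hx : ∀ a, 0 ≤ x a) :
    negLab h x = 0 := by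
  apply lab_eq_zero
  intro a
  have : (0:ℝ) ≤ x a := by exact_mod_cast hx a
  simp only [neg_nonpos]; positivity

theorem negLab_eq_succ {d : ℕ} {h : ℝ} (hh : 0 < h) {x : Fin d → ℤ} {i : Fin d} (hi : x i < 0)
    (hx : ∀ a < i, 0 ≤ x a) : negLab h x = i.succ := by
  apply lab_eq_succ
  · have : (x i : ℝ) < 0 := by exact_mod_cast hi
    nlinarith
  · intro a ha
    have : (0:ℝ) ≤ x a := by exact_mod_cast hx a ha
    simp only [neg_nonpos]; positivity

theorem negLab_zero {d : ℕ} {h : ℝ} (hh : 0 < h) {x : Fin d → ℤ} (hx : negLab h x = 0) :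
    ∀ a, 0 ≤ x a := by
  intro a
  have := lab_zero hx a
  by_contra hc
  have : (x a : ℝ) < 0 := by exact_mod_cast not_le.1 hc
  nlinarith

theorem negLab_succ {d : ℕ} {h : ℝ} (hh : 0 < h) {x : Fin d → ℤ} {i : Fin d}
    (hx : negLab h x = i.succ) : x i < 0 := by
  have := lab_succ hx
  by_contra hc
  have : (0 : ℝ) ≤ x i := by exact_mod_cast not_lt.1 hc
  nlinarith

theorem base_ne {d : ℕ} {h : ℝ} (hh : 0 < h) {x : Fin d → ℤ} (hx : x ≠ fun _ => -1) :
    Cub (negLab h) x = 0 := by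
  by_contra hne
  apply hx
  funext a
  obtain ⟨y, hy, hy0⟩ := Cub_complete hne 0
  obtain ⟨z, hz, hz0⟩ := Cub_complete hne a.succ
  have h1 := negLab_zero hh hy0 a
  have h2 := negLab_succ hh hz0
  have h3 := hy a
  have h4 := hz a
  omega

theorem base_perm {d : ℕ} {h : ℝ} (hh : 0 < h) (π : Equiv.Perm (Fin d)) (hπ : π ≠ 1) :
    (smat (negLab h) (fun _ => -1) π).det = 0 := by
  have hex : ∃ i, π i ≠ i := by
    by_contra hc
    push Not at hc
    exact hπ (Equiv.ext hc)
  obtain ⟨i, hi, hmin⟩ := WellFounded.has_min (wellFounded_lt (α := Fin d)) {i | π i ≠ i} hex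
  have hfix : ∀ a < i, π.symm a = a := by
    intro a ha
    rw [Equiv.symm_apply_eq]
    by_contra hc
    exact hmin a (fun h => hc h.symm) ha
  have hsi : i < π.symm i := by
    rcases lt_trichotomy i (π.symm i) with hl | hl | hl
    · exact hl
    · exfalso; apply hi
      show π i = i
      rw [← Equiv.eq_symm_apply]; exact hl
    · exfalso
      have := hfix _ hl
      have := π.symm.injective this
      rw [this] at hl
      exact lt_irrefl _ hl
  have key : ∀ j : ℕ, (j = i ∨ j = i + 1) → negLab h (vtx (fun _ => -1) π j) = i.succ := by
    intro j hj
    apply negLab_eq_succ hh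
    · unfold vtx
      rw [if_neg]
      · simp
      · have : (i:ℕ) < π.symm i := hsi
        omega
    · intro a ha
      unfold vtx
      rw [hfix a ha, if_pos]
      · simp
      · have : (a:ℕ) < i := ha
        omega
  have hne : (i.castSucc : Fin (d+1)) ≠ i.succ := by
    intro h; have := congrArg Fin.val h; simp at this
  apply Matrix.det_zero_of_row_eq hne
  have e1 := key (i.castSucc : Fin (d+1)) (Or.inl rfl)
  have e2 := key (i.succ : Fin (d+1)) (Or.inr rfl)
  simp only [smat, e1, e2]

theorem base_one {d : ℕ} {h : ℝ} (hh : 0 < h) :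
    (smat (d := d) (negLab h) (fun _ => -1) 1).det = (-1)^d := by
  have e1 : ∀ i : Fin d, negLab h (vtx (fun _ => -1) (1 : Equiv.Perm (Fin d)) i) = i.succ := by
    intro i
    apply negLab_eq_succ hh
    · unfold vtx
      rw [if_neg]
      · simp
      · exact lt_irrefl (i : ℕ)
    · intro a ha
      unfold vtx
      rw [if_pos]
      · simp
      · exact ha
  have e2 : negLab h (vtx (fun _ => -1) (1 : Equiv.Perm (Fin d)) d) = 0 := by
    apply negLab_eq_zero hh
    intro a
    unfold vtx
    rw [if_pos]
    · simp
    · simp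
  rw [Matrix.det_succ_row _ (Fin.last d), Fin.sum_univ_succ]
  have hs : (smat (d := d) (negLab h) (fun _ => -1) 1).submatrix (Fin.last d).succAbove
      (0 : Fin (d+1)).succAbove = 1 := by
    ext i j
    simp only [Matrix.submatrix_apply, smat, Fin.succAbove_last, Fin.val_castSucc, e1,
      Fin.succAbove_zero, Fin.cons_succ, lvec, Matrix.one_apply]
    simp
  rw [hs]
  have hz : ∀ j : Fin d, smat (d := d) (negLab h) (fun _ => -1) 1 (Fin.last d) j.succ = 0 := by
    intro j
    simp only [smat, Fin.val_last, e2, Fin.cons_succ, lvec]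
    rw [if_neg]
    exact (Fin.succ_ne_zero j).symm
  have h0 : smat (d := d) (negLab h) (fun _ => -1) 1 (Fin.last d) 0 = 1 := rfl
  simp [hz, h0]

theorem base_sum {d : ℕ} {h : ℝ} (hh : 0 < h) (B : Finset (Fin d → ℤ))
    (hB : (fun _ => -1) ∈ B) : ∑ x ∈ B, Cub (negLab h) x = (-1)^d := by
  rw [Finset.sum_eq_single_of_mem _ hB (fun x _ hx => base_ne hh hx)]
  unfold Cub
  rw [Finset.sum_eq_single_of_mem 1 (Finset.mem_univ _)
    (fun π _ hπ => by rw [base_perm hh π hπ, mul_zero]), base_one hh]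
  simp
def lat {d : ℕ} (h : ℝ) (x : Fin d → ℤ) : Fin d → ℝ := fun a => h * (x a : ℝ)

def rnd {d : ℕ} (h : ℝ) (p : Fin d → ℝ) : Fin d → ℤ := fun a => round (p a / h)

theorem lat_rnd {d : ℕ} {h : ℝ} (hh : 0 < h) (p : Fin d → ℝ) (a : Fin d) :
    |h * (rnd h p a : ℝ) - p a| ≤ h := by
  have h1 := abs_sub_round (p a / h)
  have h2 : h * (rnd h p a : ℝ) - p a = - (h * (p a / h - round (p a / h))) := by
    unfold rnd; field_simp; ring
  rw [h2, abs_neg, abs_mul, abs_of_pos hh]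
  nlinarith

def IBox (d R : ℕ) : Finset (Fin d → ℤ) := Finset.Icc (fun _ => -(R:ℤ)) (fun _ => (R:ℤ))

theorem mem_IBox {d R : ℕ} {x : Fin d → ℤ} : x ∈ IBox d R ↔ ∀ a, |x a| ≤ R := by
  simp only [IBox, Finset.mem_Icc, Pi.le_def, abs_le]
  exact forall_and.symm

/-- distance facts -/
theorem lat_near {d : ℕ} {h : ℝ} (hh : 0 < h) (p : Fin d → ℝ) (z : Fin d → ℤ) (c : ℝ) (hc0 : 0 ≤ c)
    (hz : ∀ a, |(z a : ℝ)| ≤ c) : ‖lat h (rnd h p + z) - p‖ ≤ h * (c + 1) := by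
  rw [pi_norm_le_iff_of_nonneg (by positivity)]
  intro a
  have h1 := abs_le.1 (lat_rnd hh p a)
  have h2 := abs_le.1 (hz a)
  simp only [lat, Pi.sub_apply, Pi.add_apply, Real.norm_eq_abs, Int.cast_add, abs_le]
  constructor <;> nlinarith

theorem lat_far {d : ℕ} {h : ℝ} (hh : 0 < h) (p : Fin d → ℝ) (z : Fin d → ℤ) (c : ℝ) (a : Fin d)
    (hz : c ≤ |((z a : ℝ) - rnd h p a)|) : h * (c - 1) ≤ ‖lat h z - p‖ := by
  refine le_trans ?_ (norm_le_pi_norm _ a)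
  have h1 := abs_le.1 (lat_rnd hh p a)
  simp only [lat, Pi.sub_apply, Real.norm_eq_abs]
  rw [le_abs] at hz
  rw [le_abs]
  rcases hz with hz | hz
  · left; nlinarith
  · right; nlinarith

theorem lat_close {d : ℕ} {h : ℝ} (hh : 0 < h) {x y z : Fin d → ℤ} (hy : inCube x y)
    (hz : inCube x z) : ‖lat h y - lat h z‖ ≤ h := by
  rw [pi_norm_le_iff_of_nonneg hh.le]
  intro a
  have h1 := hy a
  have h2 := hz a
  have h3 : (y a : ℝ) - z a ≤ 1 := by
    have : y a - z a ≤ 1 := by omega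
    exact_mod_cast this
  have h4 : (z a : ℝ) - y a ≤ 1 := by
    have : z a - y a ≤ 1 := by omega
    exact_mod_cast this
  simp only [lat, Pi.sub_apply, Real.norm_eq_abs, abs_le]
  constructor <;> nlinarith

theorem deg_setup {d k : ℕ} (γ : ℝ → Fin d → ℝ) (W : ℝ → (Fin d → ℝ) → (Fin d → ℝ))
    (hγ : Continuous γ)
    (hsep : ∀ t, ∀ i j : Fin k, i ≠ j → γ (t + (i:ℕ)) ≠ γ (t + (j:ℕ)))
    (hW : ContinuousOn (fun z : ℝ × (Fin d → ℝ) => W z.1 z.2) {z | ∀ i : Fin k, z.2 ≠ γ (z.1 + (i:ℕ))})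
    (hW0 : ∀ t p, (∀ i : Fin k, p ≠ γ (t + (i:ℕ))) → W t p ≠ 0) :
    ∃ r δ η : ℝ, 0 < r ∧ r ≤ 1/4 ∧ 0 < δ ∧ 0 < η ∧
      (∀ t ∈ Set.Icc (0:ℝ) k, ∀ i j : Fin k, i ≠ j → 4 * r ≤ ‖γ (t + (i:ℕ)) - γ (t + (j:ℕ))‖) ∧
      (∀ t ∈ Set.Icc (0:ℝ) k, ∀ p, ‖p‖ ≤ 4 → (∀ i : Fin k, r ≤ ‖p - γ (t + (i:ℕ))‖) → δ ≤ ‖W t p‖) ∧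
      (∀ t ∈ Set.Icc (0:ℝ) k, ∀ p, ‖p‖ ≤ 4 → (∀ i : Fin k, r ≤ ‖p - γ (t + (i:ℕ))‖) →
       ∀ t' ∈ Set.Icc (0:ℝ) k, ∀ p', ‖p'‖ ≤ 4 → (∀ i : Fin k, r ≤ ‖p' - γ (t' + (i:ℕ))‖) →
       |t - t'| < η → ‖p - p'‖ < η → ‖W t p - W t' p'‖ < δ) := by
  have hc : Continuous (fun z : ℝ × (Fin k × Fin k) => ‖γ (z.1 + ((z.2.1 : Fin k):ℕ)) - γ (z.1 + ((z.2.2 : Fin k):ℕ))‖) := by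
    have hcast : Continuous (fun i : Fin k => ((i:ℕ):ℝ)) := continuous_of_discreteTopology
    refine ((hγ.comp ?_).sub (hγ.comp ?_)).norm
    · exact continuous_fst.add (hcast.comp (continuous_fst.comp continuous_snd))
    · exact continuous_fst.add (hcast.comp (continuous_snd.comp continuous_snd))
  have hK0 : IsCompact ((Set.Icc (0:ℝ) k) ×ˢ {ij : Fin k × Fin k | ij.1 ≠ ij.2}) :=
    isCompact_Icc.prod (Set.toFinite _).isCompact
  obtain ⟨ρ, hρ0, hρ⟩ := hK0.exists_forall_le' hc.continuousOn (a := 0) (by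
    rintro ⟨t, i, j⟩ ⟨ht, hij⟩
    exact norm_pos_iff.2 (sub_ne_zero.2 (hsep t i j hij)))
  set r := min (ρ/4) (1/4) with hr
  have hr0 : 0 < r := by rw [hr]; positivity
  set K : Set (ℝ × (Fin d → ℝ)) := (Set.Icc (0:ℝ) k ×ˢ closedBall 0 4) ∩
    {z | ∀ i : Fin k, r ≤ ‖z.2 - γ (z.1 + (i:ℕ))‖} with hKdef
  have hK : IsCompact K := by
    apply (isCompact_Icc.prod (isCompact_closedBall _ _)).inter_right
    rw [Set.ofPred_forall]
    apply isClosed_iInter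
    intro i
    apply isClosed_le continuous_const
    exact (continuous_snd.sub (hγ.comp (continuous_fst.add continuous_const))).norm
  have hKU : K ⊆ {z | ∀ i : Fin k, z.2 ≠ γ (z.1 + (i:ℕ))} := by
    rintro z ⟨-, hz⟩ i he
    have := hz i
    rw [he] at this
    simp at this
    linarith
  have hWK := hW.mono hKU
  obtain ⟨δ, hδ0, hδ⟩ := hK.exists_forall_le' hWK.norm (a := 0) (by
    rintro z hz
    exact norm_pos_iff.2 (hW0 _ _ (hKU hz)))
  have huc := hK.uniformContinuousOn_of_continuous hWK
  rw [Metric.uniformContinuousOn_iff] at huc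
  obtain ⟨η, hη0, hη⟩ := huc δ hδ0
  have hmem : ∀ t ∈ Set.Icc (0:ℝ) k, ∀ p : Fin d → ℝ, ‖p‖ ≤ 4 → (∀ i : Fin k, r ≤ ‖p - γ (t + (i:ℕ))‖) → (t, p) ∈ K := by
    intro t ht p hp hi
    exact ⟨⟨ht, by simpa using hp⟩, hi⟩
  refine ⟨r, δ, η, hr0, min_le_right _ _, hδ0, hη0, ?_, ?_, ?_⟩
  · intro t ht i j hij
    have := hρ (t, i, j) ⟨ht, hij⟩
    have h2 : r ≤ ρ / 4 := min_le_left _ _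
    simp only at this
    linarith
  · intro t ht p hp hi
    exact hδ _ (hmem t ht p hp hi)
  · intro t ht p hp hi t' ht' p' hp' hi' h1 h2
    have := hη _ (hmem t ht p hp hi) _ (hmem t' ht' p' hp' hi') (by
      rw [Prod.dist_eq, max_lt_iff, Real.dist_eq, dist_eq_norm]
      exact ⟨h1, h2⟩)
    rwa [dist_eq_norm] at this
theorem deg_main {d k : ℕ} (hk : 0 < k) (γ : ℝ → Fin (d+1) → ℝ)
    (W : ℝ → (Fin (d+1) → ℝ) → (Fin (d+1) → ℝ))
    (hγ : Continuous γ) (hγ1 : ∀ t, ‖γ t‖ ≤ 1)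
    (hsep : ∀ t, ∀ i j : Fin k, i ≠ j → γ (t + (i:ℕ)) ≠ γ (t + (j:ℕ)))
    (hW : ContinuousOn (fun z : ℝ × (Fin (d+1) → ℝ) => W z.1 z.2)
      {z | ∀ i : Fin k, z.2 ≠ γ (z.1 + (i:ℕ))})
    (hW0 : ∀ t p, (∀ i : Fin k, p ≠ γ (t + (i:ℕ))) → W t p ≠ 0)
    (hfar : ∀ p, 2 ≤ ‖p‖ → W 0 p = -p)
    (hper : ∀ j : Fin k, W (j:ℕ) = W 0) : (k:ℤ) ∣ 1 := by
  obtain ⟨r, δ, η, hr0, hr4, hδ0, hη0, hsepr, hlow, hclose⟩ := deg_setup γ W hγ hsep hW hW0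
  have huγ := (isCompact_Icc (a := (0:ℝ)) (b := (k:ℝ))).uniformContinuousOn_of_continuous hγ.continuousOn
  rw [Metric.uniformContinuousOn_iff] at huγ
  obtain ⟨ε, hε0, hε⟩ := huγ (η/2) (by positivity)
  obtain ⟨N, hN⟩ := exists_nat_gt (max 6 (6 * r / η))
  have hN6 : (6:ℝ) < N := lt_of_le_of_lt (le_max_left _ _) hN
  have hNη : 6 * r / η < N := lt_of_le_of_lt (le_max_right _ _) hN
  have hN0 : (0:ℝ) < N := by linarith
  obtain ⟨h, hh⟩ : ∃ h, h = r / N := ⟨_, rfl⟩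
  have hhN : h * N = r := by rw [hh]; field_simp
  have hh0 : 0 < h := by rw [hh]; positivity
  have hhη : 6 * h < η := by
    rw [div_lt_iff₀ hη0] at hNη
    nlinarith
  have hhr : 6 * h < r := by nlinarith
  clear hh hN hNη
  set L : ℝ → (Fin (d+1) → ℤ) → Fin (d+2) := fun t x => lab (W t (lat h x)) with hL
  set b : ℝ → Fin (d+1) → ℤ := fun t => rnd h (γ t) with hb
  set R : ℕ := N + 2 with hR
  have hRr : (R:ℝ) = N + 2 := by rw [hR]; push_cast; ring
  set J : ℝ → ℤ := fun t => ∑ u ∈ IBox (d+1) R, Cub (L t) (b t + u) with hJ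
  have z0 : (⟨0, hk⟩ : Fin k).val = 0 := rfl
  have hstep : ∀ t ∈ Set.Icc (0:ℝ) k, ∀ t' ∈ Set.Icc (0:ℝ) k, |t - t'| < min ε η → J t = J t' := by
    intro t ht t' ht' htt
    simp only [hJ, ← Cub_trans]
    apply homLemma _ {u | ∀ a, |u a| ≤ (N:ℤ) + 1}
    · intro x y hxy hy
      rw [mem_IBox]
      intro a
      have h1 := abs_le.1 (hy a)
      have h2 := hxy a
      rw [abs_le, hR]; push_cast
      constructor <;> omega
    · intro x hx y hxy hy
      simp only [Set.mem_ofPred_eq, not_forall, not_le] at hy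
      obtain ⟨a, ha⟩ := hy
      rw [mem_IBox] at hx
      have hp : ∀ s ∈ Set.Icc (0:ℝ) k, ∀ z, inCube x z → ‖lat h (b s + z)‖ ≤ 4 ∧
          ∀ i : Fin k, r ≤ ‖lat h (b s + z) - γ (s + (i:ℕ))‖ := by
        intro s hs z hz
        have hnear : ‖lat h (b s + z) - γ s‖ ≤ h * ((N + 3) + 1) := by
          apply lat_near hh0 _ _ _ (by positivity)
          intro a'
          have h1 := abs_le.1 (hx a')
          have h2 := hz a'
          have : |z a'| ≤ (N:ℤ) + 3 := by
            rw [hR] at h1; push_cast at h1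
            rw [abs_le]; constructor <;> omega
          exact_mod_cast this
        have hfar' : h * ((N + 1) - 1) ≤ ‖lat h (b s + z) - γ s‖ := by
          apply lat_far hh0 _ _ _ a
          have h1 := hz a
          have h2 := hxy a
          have h3 : (N:ℤ) + 1 ≤ |z a| := by
            rw [lt_abs] at ha
            rw [le_abs]; omega
          have h4 : (((b s + z) a : ℤ) : ℝ) - rnd h (γ s) a = z a := by
            simp [hb]
          rw [h4]
          exact_mod_cast h3
        have hnear2 : ‖lat h (b s + z) - γ s‖ ≤ 2 * r := by nlinarith
        constructor
        · have := norm_le_norm_add_norm_sub' (lat h (b s + z)) (γ s)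
          have := hγ1 s
          linarith
        · intro i
          by_cases hi : i = ⟨0, hk⟩
          · subst hi
            simp only [Nat.cast_zero, add_zero]
            nlinarith
          · have h1 := hsepr s hs i ⟨0, hk⟩ hi
            simp only [Nat.cast_zero, add_zero] at h1
            have h2 := norm_sub_le_norm_sub_add_norm_sub (γ (s + (i:ℕ))) (lat h (b s + z)) (γ s)
            rw [norm_sub_rev (γ (s + (i:ℕ))) (lat h (b s + z))] at h2
            linarith
      have hpp : ∀ s ∈ Set.Icc (0:ℝ) k, ∀ s' ∈ Set.Icc (0:ℝ) k, |s - s'| < min ε η →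
          ∀ z, inCube x z → ∀ z', inCube x z' → ‖lat h (b s + z) - lat h (b s' + z')‖ < η := by
        intro s hs s' hs' hss z hz z' hz'
        have hd := hε s hs s' hs' (by rw [Real.dist_eq]; exact lt_of_lt_of_le hss (min_le_left _ _))
        rw [dist_eq_norm] at hd
        have e : lat h (b s + z) - lat h (b s' + z') =
            (lat h (b s + 0) - γ s) - (lat h (b s' + 0) - γ s') + (γ s - γ s') + (lat h z - lat h z') := by
          funext a; simp [lat]; ring
        have n1 := lat_near hh0 (γ s) 0 0 le_rfl (by simp)
        have n2 := lat_near hh0 (γ s') 0 0 le_rfl (by simp)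
        have n3 := lat_close hh0 hz hz'
        rw [e]
        have m1 := norm_add_le ((lat h (b s + 0) - γ s) - (lat h (b s' + 0) - γ s') + (γ s - γ s')) (lat h z - lat h z')
        have m2 := norm_add_le ((lat h (b s + 0) - γ s) - (lat h (b s' + 0) - γ s')) (γ s - γ s')
        have m3 := norm_sub_le (lat h (b s + 0) - γ s) (lat h (b s' + 0) - γ s')
        simp only [hb] at m1 m2 m3 ⊢
        linarith
      have hτ : ∀ s s', (s = t ∨ s = t') → (s' = t ∨ s' = t') → |s - s'| < min ε η := by
        have hp0 : 0 < min ε η := lt_min hε0 hη0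
        rintro s s' (rfl | rfl) (rfl | rfl)
        · simpa using ⟨hε0, hη0⟩
        · exact htt
        · rw [abs_sub_comm]; exact htt
        · simpa using ⟨hε0, hη0⟩
      have hIcc : ∀ s, (s = t ∨ s = t') → s ∈ Set.Icc (0:ℝ) k := by
        rintro s (rfl | rfl) <;> assumption
      obtain ⟨l, hl⟩ := lab_incomplete hδ0
        {w | ∃ s, (s = t ∨ s = t') ∧ ∃ z, inCube x z ∧ w = W s (lat h (b s + z))}
        (by
          rintro w ⟨s, hs, z, hz, rfl⟩
          exact hlow s (hIcc s hs) _ (hp s (hIcc s hs) z hz).1 (hp s (hIcc s hs) z hz).2)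
        (by
          rintro w ⟨s, hs, z, hz, rfl⟩ w' ⟨s', hs', z', hz', rfl⟩
          exact hclose s (hIcc s hs) _ (hp s (hIcc s hs) z hz).1 (hp s (hIcc s hs) z hz).2
            s' (hIcc s' hs') _ (hp s' (hIcc s' hs') z' hz').1 (hp s' (hIcc s' hs') z' hz').2
            (lt_of_lt_of_le (hτ s s' hs hs') (min_le_right _ _))
            (hpp s (hIcc s hs) s' (hIcc s' hs') (hτ s s' hs hs') z hz z' hz'))
      refine ⟨l, fun z hz => ⟨?_, ?_⟩⟩
      · exact hl _ ⟨t, Or.inl rfl, z, hz, rfl⟩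
      · exact hl _ ⟨t', Or.inr rfl, z, hz, rfl⟩
  have hconst : ∀ j : Fin k, J (j:ℕ) = J 0 := by
    have hp0 : 0 < min ε η := lt_min hε0 hη0
    obtain ⟨M, hM⟩ := exists_nat_one_div_lt hp0
    have hM0 : (0:ℝ) < M + 1 := by positivity
    have hind : ∀ s : ℕ, s ≤ k * (M+1) → J (s / (M+1)) = J 0 := by
      intro s
      induction s with
      | zero => intro _; simp
      | succ s ih =>
        intro hs
        rw [← ih (by omega)]
        have hs' : ((s:ℝ) + 1) ≤ k * (M+1) := by exact_mod_cast hs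
        apply hstep
        · constructor
          · positivity
          · rw [div_le_iff₀ hM0]; push_cast; exact hs'
        · constructor
          · positivity
          · rw [div_le_iff₀ hM0]; linarith
        · have : ((s+1 : ℕ):ℝ) / (M+1) - s / (M+1) = 1 / (M+1) := by push_cast; ring
          rw [this, abs_of_pos (by positivity)]
          exact hM
    intro j
    have := hind (j * (M+1)) (Nat.mul_le_mul_right _ j.2.le)
    have e : (((j:ℕ) * (M+1) : ℕ):ℝ) / (M+1) = (j:ℕ) := by push_cast; field_simp
    rwa [e] at this
  -- total
  obtain ⟨Λ, hΛ⟩ : ∃ Λ : ℕ, Λ = ⌈3 / h⌉₊ := ⟨_, rfl⟩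
  have hΛ1 : 3 ≤ h * Λ := by
    have := Nat.le_ceil (3 / h)
    rw [← hΛ, div_le_iff₀ hh0] at this
    linarith
  have hΛ2 : h * Λ ≤ 3 + h := by
    have := (Nat.ceil_lt_add_one (show 0 ≤ 3 / h by positivity)).le
    rw [← hΛ] at this
    have e : h * (3 / h + 1) = 3 + h := by field_simp
    nlinarith
  have hT1 : ∑ x ∈ IBox (d+1) Λ, Cub (L 0) x = (-1)^(d+1) := by
    rw [← base_sum hh0 (IBox (d+1) Λ)]
    · apply factA
      intro x y hxy hne
      have hlt : ‖lat h y‖ < 2 := by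
        by_contra hc
        apply hne
        simp only [hL, hfar _ (not_lt.1 hc), negLab]
        rfl
      rw [mem_IBox]
      intro a
      have h1 := lt_of_le_of_lt (norm_le_pi_norm _ a) hlt
      simp only [lat, Real.norm_eq_abs] at h1
      rw [abs_lt] at h1
      have h2 := hxy a
      have h3 : (x a : ℝ) ≤ y a := by exact_mod_cast h2.1
      have h4 : (y a : ℝ) ≤ x a + 1 := by exact_mod_cast h2.2
      have : |(x a : ℝ)| ≤ Λ := by
        rw [abs_le]; constructor <;> nlinarith
      exact_mod_cast this
    · rw [mem_IBox]
      intro a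
      have : (1:ℝ) ≤ Λ := by nlinarith
      simp
      exact_mod_cast this
  have hT2 : ∑ x ∈ IBox (d+1) Λ, Cub (L 0) x = ∑ j : Fin k, J (j:ℕ) := by
    have hJj : ∀ j : Fin k, J (j:ℕ) = ∑ x ∈ (IBox (d+1) R).image (fun u => b (j:ℕ) + u), Cub (L 0) x := by
      intro j
      rw [Finset.sum_image (by intro u _ v _ huv; exact add_left_cancel huv)]
      simp only [hJ, hL, hper j]
    simp only [hJj]
    rw [← Finset.sum_biUnion]
    · symm
      apply Finset.sum_subset
      · intro x hx
        simp only [Finset.mem_biUnion, Finset.mem_univ, true_and, Finset.mem_image] at hx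
        obtain ⟨j, u, hu, rfl⟩ := hx
        rw [mem_IBox] at hu ⊢
        intro a
        have h1 := lat_rnd hh0 (γ (j:ℕ)) a
        have h2 := le_trans (norm_le_pi_norm _ a) (hγ1 (j:ℕ))
        have h3 : |(u a : ℝ)| ≤ R := by exact_mod_cast hu a
        rw [Real.norm_eq_abs] at h2
        rw [abs_le] at h1 h2 h3
        rw [hRr] at h3
        have : |((b (j:ℕ) a : ℝ) + u a)| ≤ Λ := by
          simp only [hb]
          rw [abs_le]
          constructor
          · by_contra hc
            push Not at hc
            nlinarith
          · by_contra hc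
            push Not at hc
            nlinarith
        exact_mod_cast this
      · intro x hx hxn
        by_contra hne
        simp only [Finset.mem_biUnion, Finset.mem_univ, true_and, Finset.mem_image, not_exists, not_and] at hxn
        rw [mem_IBox] at hx
        have h0 : (0:ℝ) ∈ Set.Icc (0:ℝ) k := ⟨le_rfl, by positivity⟩
        have hp : ∀ z, inCube x z → ‖lat h z‖ ≤ 4 ∧
          ∀ i : Fin k, r ≤ ‖lat h z - γ (0 + (i:ℕ))‖ := by
          intro z hz
          constructor
          · rw [pi_norm_le_iff_of_nonneg (by norm_num)]
            intro a
            have h1 := abs_le.1 (hx a)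
            have h2 := hz a
            have h3 : |z a| ≤ (Λ:ℤ) + 1 := by rw [abs_le]; constructor <;> omega
            have h4 : |(z a : ℝ)| ≤ Λ + 1 := by exact_mod_cast h3
            simp only [lat, Real.norm_eq_abs, abs_mul, abs_of_pos hh0]
            nlinarith
          · intro i
            rw [zero_add]
            have hx2 : x - b (i:ℕ) ∉ IBox (d+1) R := by
              intro hc
              exact hxn i _ hc (by simp)
            rw [mem_IBox] at hx2
            push Not at hx2
            obtain ⟨a, ha⟩ := hx2
            have hf := lat_far hh0 (γ (i:ℕ)) z (R : ℝ) a (by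
              have h2 := hz a
              have : (R:ℤ) ≤ |z a - b (i:ℕ) a| := by
                rw [lt_abs] at ha
                simp only [Pi.sub_apply] at ha
                rw [le_abs]; omega
              exact_mod_cast this)
            rw [hRr] at hf
            nlinarith
        obtain ⟨l, hl⟩ := lab_incomplete hδ0 {w | ∃ z, inCube x z ∧ w = W 0 (lat h z)}
          (by
            rintro w ⟨z, hz, rfl⟩
            exact hlow 0 h0 _ (hp z hz).1 (hp z hz).2)
          (by
            rintro w ⟨z, hz, rfl⟩ w' ⟨z', hz', rfl⟩
            refine hclose 0 h0 _ (hp z hz).1 (hp z hz).2 0 h0 _ (hp z' hz').1 (hp z' hz').2 (by simpa using hη0) ?_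
            have := lat_close hh0 hz hz'
            linarith)
        obtain ⟨z, hz, hzl⟩ := Cub_complete hne l
        exact hl _ ⟨z, hz, rfl⟩ hzl
    · intro i _ j _ hij
      rw [Function.onFun, Finset.disjoint_left]
      intro x hx hx'
      simp only [Finset.mem_image] at hx hx'
      obtain ⟨u, hu, rfl⟩ := hx
      obtain ⟨v, hv, huv⟩ := hx'
      rw [mem_IBox] at hu hv
      have h0 : (0:ℝ) ∈ Set.Icc (0:ℝ) k := ⟨le_rfl, by positivity⟩
      have hs := hsepr 0 h0 i j hij
      rw [zero_add, zero_add] at hs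
      have n1 := lat_near hh0 (γ (i:ℕ)) u R (by positivity) (fun a => by exact_mod_cast hu a)
      have n2 := lat_near hh0 (γ (j:ℕ)) v R (by positivity) (fun a => by exact_mod_cast hv a)
      change rnd h (γ (j:ℕ)) + v = rnd h (γ (i:ℕ)) + u at huv
      rw [huv] at n2
      have h2 := norm_sub_le_norm_sub_add_norm_sub (γ (i:ℕ)) (lat h (rnd h (γ (i:ℕ)) + u)) (γ (j:ℕ))
      rw [norm_sub_rev (γ (i:ℕ)) (lat h _)] at h2
      rw [hRr] at n1 n2
      nlinarith
  rw [hT1] at hT2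
  simp only [hconst, Finset.sum_const, Finset.card_univ, Fintype.card_fin, nsmul_eq_mul] at hT2
  have : (k:ℤ) ∣ (-1)^(d+1) := ⟨J 0, hT2⟩
  have h3 := this.mul_left ((-1)^(d+1))
  rwa [← mul_pow, show (-1:ℤ) * -1 = 1 by norm_num, one_pow] at h3
def gam (d k : ℕ) (t : ℝ) : E (d+2) :=
  EuclideanSpace.single 0 (Real.cos (2 * Real.pi * t / k) / 4) +
    EuclideanSpace.single 1 (Real.sin (2 * Real.pi * t / k) / 4)

theorem gam_cont (d k : ℕ) : Continuous (gam d k) := by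
  have h : gam d k = fun t => (Real.cos (2 * Real.pi * t / k) / 4) • EuclideanSpace.single 0 (1:ℝ) +
    (Real.sin (2 * Real.pi * t / k) / 4) • EuclideanSpace.single 1 (1:ℝ) := by
    funext t
    ext a
    simp [gam, Pi.single_apply]
  rw [h]
  fun_prop

theorem gam_norm (d k : ℕ) (t : ℝ) : ‖gam d k t‖ ≤ 1/2 := by
  unfold gam
  refine (norm_add_le _ _).trans ?_
  simp only [EuclideanSpace.norm_single, Real.norm_eq_abs, abs_div]
  have h1 := Real.abs_cos_le_one (2 * Real.pi * t / k)
  have h2 := Real.abs_sin_le_one (2 * Real.pi * t / k)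
  rw [abs_of_pos (show (0:ℝ) < 4 by norm_num)]
  linarith

theorem gam_per (d k : ℕ) (hk : 0 < k) : Function.Periodic (gam d k) k := by
  intro t
  have hk' : (k:ℝ) ≠ 0 := by positivity
  have : 2 * Real.pi * (t + k) / k = 2 * Real.pi * t / k + 2 * Real.pi := by field_simp
  unfold gam
  rw [this, Real.cos_add_two_pi, Real.sin_add_two_pi]

theorem gam_inj (d k : ℕ) (hk : 0 < k) (t : ℝ) (i j : Fin k) (h : gam d k (t + (i:ℕ)) = gam d k (t + (j:ℕ))) :
    i = j := by
  have h0 : (gam d k (t + (i:ℕ))) 0 = (gam d k (t + (j:ℕ))) 0 := by rw [h]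
  have h1 : (gam d k (t + (i:ℕ))) 1 = (gam d k (t + (j:ℕ))) 1 := by rw [h]
  simp [gam] at h0 h1
  have ha := Real.Angle.cos_sin_inj h0 h1
  rw [Real.Angle.angle_eq_iff_two_pi_dvd_sub] at ha
  obtain ⟨z, hz⟩ := ha
  have hk' : (k:ℝ) ≠ 0 := by positivity
  have hpi := Real.pi_ne_zero
  have h2 : ((i:ℕ):ℝ) - (j:ℕ) = k * z := by
    field_simp at hz
    linarith
  have h3 : ((i:ℕ):ℤ) - (j:ℕ) = k * z := by exact_mod_cast h2
  have hi := i.2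
  have hj := j.2
  have hz0 : z = 0 := by
    have a1 : (k:ℤ) * z < k * 1 := by rw [← h3]; omega
    have a2 : (k:ℤ) * (-1) < k * z := by rw [← h3]; omega
    have kp : (0:ℤ) < k := by exact_mod_cast hk
    have := lt_of_mul_lt_mul_left a1 kp.le
    have := lt_of_mul_lt_mul_left a2 kp.le
    omega
  subst hz0
  ext; omega

theorem gam_mod (d k : ℕ) (hk : 0 < k) (a : ℕ) : gam d k (a : ℕ) = gam d k ((a % k : ℕ) : ℝ) := by
  have h := (gam_per d k hk).nat_mul (a / k) ((a % k : ℕ) : ℝ)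
  rw [← h]
  congr 1
  have := Nat.mod_add_div a k
  rw [mul_comm] at this
  exact_mod_cast this.symm.trans (by ring)

def cfg (d k : ℕ) (t : ℝ) (p : E (d+2)) : Fin (k+1) → E (d+2) :=
  Fin.cons p (fun i : Fin k => gam d k (t + (i:ℕ)))

theorem cfg_mem (d k : ℕ) (hk : 0 < k) (t : ℝ) (p : E (d+2)) (hp : ‖p‖ ≤ 1)
    (hne : ∀ i : Fin k, p ≠ gam d k (t + (i:ℕ))) : cfg d k t p ∈ PConf (d+2) (k+1) := by
  constructor
  · intro i
    refine Fin.cases ?_ (fun i => ?_) i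
    · simpa [cfg, Dball] using hp
    · have := gam_norm d k (t + (i:ℕ))
      simp only [cfg, Dball, Fin.cons_succ, mem_closedBall, dist_zero_right]
      linarith
  · unfold cfg
    rw [Fin.cons_injective_iff]
    refine ⟨?_, fun i j hij => gam_inj d k hk t i j hij⟩
    rintro ⟨i, hi⟩
    exact hne i hi.symm

theorem cfg_cont (d k : ℕ) : Continuous (fun z : ℝ × E (d+2) => cfg d k z.1 z.2) := by
  apply continuous_pi
  intro i
  refine Fin.cases ?_ (fun i => ?_) i
  · simpa [cfg] using continuous_snd
  · simp only [cfg, Fin.cons_succ]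
    exact (gam_cont d k).comp (continuous_fst.add continuous_const)

open Classical in
def FF {d k : ℕ} (f : ConfQ (d+2) (k+1) → ↥(Dball (d+2))) (t : ℝ) (p : E (d+2)) : E (d+2) :=
  if h : cfg d k t p ∈ PConf (d+2) (k+1) then (f ⟦⟨cfg d k t p, h⟩⟧ : E (d+2)) else 0

theorem FF_norm {d k : ℕ} (f : ConfQ (d+2) (k+1) → ↥(Dball (d+2))) (t : ℝ) (p : E (d+2)) :
    ‖FF f t p‖ ≤ 1 := by
  unfold FF
  split_ifs with h
  · have := (f ⟦⟨cfg d k t p, h⟩⟧).2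
    simpa [Dball] using this
  · simp

theorem FF_per {d k : ℕ} (hk : 0 < k) (f : ConfQ (d+2) (k+1) → ↥(Dball (d+2))) (j : Fin k) (p : E (d+2)) :
    FF f (j:ℕ) p = FF f 0 p := by
  classical
  have : NeZero k := ⟨hk.ne'⟩
  set τ : Equiv.Perm (Fin (k+1)) := Equiv.Perm.decomposeFin.symm (0, Equiv.addRight j) with hτ
  have h1 : cfg d k (j:ℕ) p = cfg d k 0 p ∘ τ := by
    funext i
    refine Fin.cases ?_ (fun i => ?_) i
    · simp [cfg, hτ]
    · simp only [cfg, hτ, Function.comp_apply, Equiv.Perm.decomposeFin_symm_apply_succ, Equiv.swap_self,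
        Equiv.refl_apply, Fin.cons_succ, Equiv.coe_addRight, Fin.val_add, zero_add]
      rw [← gam_mod d k hk]
      congr 1
      push_cast; ring
  have h2 : cfg d k (j:ℕ) p ∈ PConf (d+2) (k+1) ↔ cfg d k 0 p ∈ PConf (d+2) (k+1) := by
    rw [h1]
    constructor
    · rintro ⟨a, b⟩
      refine ⟨fun i => ?_, ?_⟩
      · have := a (τ.symm i)
        simpa using this
      · have := b.comp τ.symm.injective
        simpa [Function.comp_assoc] using this
    · rintro ⟨a, b⟩
      exact ⟨fun i => a _, b.comp τ.injective⟩
  unfold FF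
  by_cases h : cfg d k 0 p ∈ PConf (d+2) (k+1)
  · rw [dif_pos h, dif_pos (h2.2 h)]
    congr 2
    apply Quotient.sound
    refine ⟨τ⁻¹, Subtype.ext ?_⟩
    show cfg d k 0 p ∘ ⇑(τ⁻¹)⁻¹ = cfg d k (j:ℕ) p
    rw [inv_inv, h1]
  · rw [dif_neg h, dif_neg (fun h' => h (h2.1 h'))]

def ret {d : ℕ} (p : E d) : E d := (max 1 ‖p‖)⁻¹ • p

theorem ret_cont {d : ℕ} : Continuous (ret (d := d)) := by
  have h : Continuous (fun p : E d => (max 1 ‖p‖)⁻¹) := by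
    apply Continuous.inv₀ (by fun_prop)
    intro p
    have : (1:ℝ) ≤ max 1 ‖p‖ := le_max_left _ _
    linarith
  exact Continuous.smul h continuous_id

theorem ret_in {d : ℕ} {p : E d} (h : ‖p‖ ≤ 1) : ret p = p := by
  simp [ret, max_eq_left h]

theorem ret_out {d : ℕ} {p : E d} (h : 1 < ‖p‖) : ‖ret p‖ = 1 := by
  rw [ret, max_eq_right h.le, norm_smul, norm_inv, norm_norm]
  field_simp

def WW {d k : ℕ} (f : ConfQ (d+2) (k+1) → ↥(Dball (d+2))) (t : ℝ) (p : Fin (d+2) → ℝ) : Fin (d+2) → ℝ :=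
  WithLp.ofLp ((max 0 (min 1 (2 - ‖(WithLp.toLp 2 p : E (d+2))‖))) • FF f t (ret (WithLp.toLp 2 p)) -
    (WithLp.toLp 2 p : E (d+2)))

theorem ret_cfg {d k : ℕ} (hk : 0 < k) (t : ℝ) (p : E (d+2))
    (hne : ∀ i : Fin k, p ≠ gam d k (t + (i:ℕ))) : cfg d k t (ret p) ∈ PConf (d+2) (k+1) := by
  by_cases h : ‖p‖ ≤ 1
  · rw [ret_in h]; exact cfg_mem d k hk t p h hne
  · push Not at h
    have h1 := ret_out h
    refine cfg_mem d k hk t _ h1.le ?_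
    intro i hi
    have := gam_norm d k (t + (i:ℕ))
    rw [← hi, h1] at this
    norm_num at this

theorem WW_cont {d k : ℕ} (hk : 0 < k) (f : ConfQ (d+2) (k+1) → ↥(Dball (d+2))) (hf : Continuous f) :
    ContinuousOn (fun z : ℝ × (Fin (d+2) → ℝ) => WW f z.1 z.2)
      {z | ∀ i : Fin k, z.2 ≠ WithLp.ofLp (gam d k (z.1 + (i:ℕ)))} := by
  have hto : Continuous (fun z : ℝ × (Fin (d+2) → ℝ) => (WithLp.toLp 2 z.2 : E (d+2))) :=
    (PiLp.continuous_toLp 2 _).comp continuous_snd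
  have hFF : ContinuousOn (fun z : ℝ × (Fin (d+2) → ℝ) => FF f z.1 (ret (WithLp.toLp 2 z.2)))
      {z | ∀ i : Fin k, z.2 ≠ WithLp.ofLp (gam d k (z.1 + (i:ℕ)))} := by
    rw [continuousOn_iff_continuous_domRestrict]
    have hmem : ∀ z : {z : ℝ × (Fin (d+2) → ℝ) | ∀ i : Fin k, z.2 ≠ WithLp.ofLp (gam d k (z.1 + (i:ℕ)))},
        cfg d k z.1.1 (ret (WithLp.toLp 2 z.1.2)) ∈ PConf (d+2) (k+1) := by
      intro z
      apply ret_cfg hk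
      intro i hi
      apply z.2 i
      rw [← hi]
    have e : Set.domRestrict {z | ∀ i : Fin k, z.2 ≠ WithLp.ofLp (gam d k (z.1 + (i:ℕ)))}
        (fun z : ℝ × (Fin (d+2) → ℝ) => FF f z.1 (ret (WithLp.toLp 2 z.2))) =
        fun z => (f ⟦⟨_, hmem z⟩⟧ : E (d+2)) := by
      funext z
      simp only [Set.domRestrict_apply, FF]
      rw [dif_pos (hmem z)]
    rw [e]
    apply continuous_subtype_val.comp
    apply hf.comp
    apply continuous_quotient_mk'.comp
    apply Continuous.subtype_mk
    exact (cfg_cont d k).comp ((continuous_fst.comp continuous_subtype_val).prodMk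
      (ret_cont.comp (hto.comp continuous_subtype_val)))
  unfold WW
  apply (PiLp.continuous_ofLp 2 _).comp_continuousOn
  apply ContinuousOn.sub _ hto.continuousOn
  have hχ : Continuous (fun z : ℝ × (Fin (d+2) → ℝ) =>
      max 0 (min 1 (2 - ‖(WithLp.toLp 2 z.2 : E (d+2))‖))) :=
    continuous_const.max (continuous_const.min (continuous_const.sub hto.norm))
  exact ContinuousOn.smul hχ.continuousOn hFF

theorem sup_le_two {d : ℕ} (p : Fin d → ℝ) : ‖p‖ ≤ ‖(WithLp.toLp 2 p : E d)‖ := by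
  rw [pi_norm_le_iff_of_nonneg (norm_nonneg _)]
  intro i
  exact PiLp.norm_apply_le (WithLp.toLp 2 p : E d) i

theorem conf_aux (d k : ℕ) (hk : 2 ≤ k)
    (f : ConfQ (d+2) (k+1) → ↥(Dball (d+2))) (hf : Continuous f)
    (hno : ∀ (p : ↥(PConf (d+2) (k+1))) (i : Fin (k+1)),
      (f ⟦p⟧ : E (d+2)) ≠ (p : Fin (k+1) → E (d+2)) i) : False := by
  have hk0 : 0 < k := by omega
  have := deg_main hk0 (fun t => WithLp.ofLp (gam d k t)) (WW f)
    ((PiLp.continuous_ofLp 2 _).comp (gam_cont d k))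
    (by
      intro t
      refine (sup_le_two _).trans ?_
      have := gam_norm d k t
      simp only [WithLp.toLp_ofLp]
      linarith)
    (by
      intro t i j hij he
      exact hij (gam_inj d k hk0 t i j (WithLp.ofLp_injective 2 he)))
    (WW_cont hk0 f hf)
    (by
      intro t p hp h0
      have hp' : ∀ i : Fin k, (WithLp.toLp 2 p : E (d+2)) ≠ gam d k (t + (i:ℕ)) := by
        intro i hi
        apply hp i
        simp only [← hi]
      have h1 : (max 0 (min 1 (2 - ‖(WithLp.toLp 2 p : E (d+2))‖))) • FF f t (ret (WithLp.toLp 2 p)) =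
          (WithLp.toLp 2 p : E (d+2)) := by
        rw [← sub_eq_zero]
        apply WithLp.ofLp_injective 2
        exact h0
      by_cases h : ‖(WithLp.toLp 2 p : E (d+2))‖ ≤ 1
      · have hm := ret_cfg hk0 t _ hp'
        rw [ret_in h] at h1 hm
        rw [min_eq_left (by linarith), max_eq_right (by norm_num), one_smul] at h1
        rw [FF, dif_pos hm] at h1
        exact hno ⟨_, hm⟩ 0 h1
      · push Not at h
        have h2 := FF_norm f t (ret (WithLp.toLp 2 p))
        have h3 := congrArg norm h1
        rw [norm_smul, Real.norm_eq_abs, abs_of_nonneg (le_max_left _ _)] at h3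
        have h4 : max 0 (min 1 (2 - ‖(WithLp.toLp 2 p : E (d+2))‖)) ≤ 1 :=
          max_le zero_le_one (min_le_left _ _)
        have h5 : (0:ℝ) ≤ max 0 (min 1 (2 - ‖(WithLp.toLp 2 p : E (d+2))‖)) := le_max_left _ _
        have h6 := mul_le_one₀ h4 (norm_nonneg _) h2
        linarith)
    (by
      intro p hp
      have h2 := hp.trans (sup_le_two p)
      unfold WW
      rw [max_eq_left ((min_le_right _ _).trans (by linarith))]
      simp)
    (by
      intro j
      funext p
      simp only [WW, FF_per hk0])
  have h1 : (k:ℤ) ≤ 1 := Int.le_of_dvd one_pos this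
  omega

/-- For `m ≥ 2` and `n ≥ 3`, every continuous map `f : Confₙ(D^m) → D^m` has a
"fixed point": some configuration `S = {p₁, …, pₙ}` with `f(S) ∈ S`. -/
theorem conf_fixed_point (m n : ℕ) (hm : 2 ≤ m) (hn : 3 ≤ n)
    (f : ConfQ m n → ↥(Dball m)) (hf : Continuous f) :
    ∃ (p : ↥(PConf m n)) (i : Fin n),
      (f ⟦p⟧ : E m) = (p : Fin n → E m) i := by

  obtain ⟨d, rfl⟩ : ∃ d, m = d + 2 := ⟨m - 2, by omega⟩
  obtain ⟨k, rfl⟩ : ∃ k, n = k + 1 := ⟨n - 1, by omega⟩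
  by_contra hc
  push Not at hc
  exact conf_aux d k (by omega) f hf hc
end
end
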